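/- There exist absolute constants c, C > 0 such that, with probability 1 − o(1) for a random pair (g,h) ∈ Sym(n) × Sym(n), every 3-cycle in Sym(n) can be written as a product of at most C·n·(log n)^c elements of S = {g, h, g⁻¹, h⁻¹}. -/

import Mathlib

open Equiv

namespace RandGen

set_option linter.unusedSectionVars false
set_option linter.unusedDecidableInType false

open Finset
open scoped BigOperators Classical

section Probability
variable {Ω Ω' : Type*} [Fintype Ω] [Fintype Ω']

/-- The probability of an event for a uniformly random element of a finite type. -/
noncomputable def pr (A : Ω → Prop) : ℝ := 𝔼 ω, (if A ω then (1 : ℝ) else 0)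

lemma pr_eq_expect (A : Ω → Prop) [DecidablePred A] :
    pr A = 𝔼 ω, (if A ω then (1 : ℝ) else 0) := by
  unfold pr; congr!

lemma pr_eq_card (A : Ω → Prop) :
    pr A = ((univ.filter A).card : ℝ) / (Fintype.card Ω : ℝ) := by
  rw [pr, Fintype.expect_eq_sum_div_card, Finset.sum_boole]

lemma pr_nonneg (A : Ω → Prop) : 0 ≤ pr A := by
  rw [pr_eq_card]; positivity

lemma pr_mono {A B : Ω → Prop} (h : ∀ ω, A ω → B ω) : pr A ≤ pr B := by
  refine Finset.expect_le_expect fun ω _ => ?_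
  by_cases hA : A ω
  · simp [hA, h ω hA]
  · simp only [hA, if_false]; split_ifs <;> norm_num

lemma pr_le_one (A : Ω → Prop) : pr A ≤ 1 := by
  rw [pr_eq_card]
  refine div_le_one_of_le₀ ?_ (by positivity)
  exact_mod_cast Finset.card_le_univ _

lemma pr_congr {A B : Ω → Prop} (h : ∀ ω, A ω ↔ B ω) : pr A = pr B := by
  congr 1; ext ω; exact h ω

lemma pr_or_le (A B : Ω → Prop) : pr (fun ω => A ω ∨ B ω) ≤ pr A + pr B := by
  rw [pr, pr, pr, ← Finset.expect_add_distrib]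
  refine Finset.expect_le_expect fun ω _ => ?_
  by_cases hA : A ω <;> by_cases hB : B ω <;> simp [hA, hB]

lemma pr_exists_le {ι : Type*} [Fintype ι] (A : ι → Ω → Prop) :
    pr (fun ω => ∃ i, A i ω) ≤ ∑ i, pr (A i) := by
  simp only [pr]
  rw [← Finset.expect_sum_comm]
  refine Finset.expect_le_expect fun ω _ => ?_
  split_ifs with h
  · obtain ⟨i, hi⟩ := h
    calc (1 : ℝ) = if A i ω then 1 else 0 := by simp [hi]
      _ ≤ _ := Finset.single_le_sum (f := fun i => if A i ω then (1 : ℝ) else 0)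
        (fun j _ => by positivity) (mem_univ i)
  · positivity

lemma pr_exists_mem_le {ι : Type*} (s : Finset ι) (A : ι → Ω → Prop) :
    pr (fun ω => ∃ i ∈ s, A i ω) ≤ ∑ i ∈ s, pr (A i) := by
  rw [← Finset.sum_coe_sort]
  refine le_trans (pr_mono ?_) (pr_exists_le (fun i : s => A i))
  rintro ω ⟨i, hi, h⟩
  exact ⟨⟨i, hi⟩, h⟩

lemma pr_equiv (e : Ω ≃ Ω') (A : Ω' → Prop) : pr (fun ω => A (e ω)) = pr A :=
  Fintype.expect_equiv e _ _ fun _ => rfl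

lemma pr_compl [Nonempty Ω] (A : Ω → Prop) : pr (fun ω => ¬ A ω) = 1 - pr A := by
  rw [eq_sub_iff_add_eq, pr, pr, ← Finset.expect_add_distrib]
  refine (Finset.expect_congr rfl fun ω _ => ?_).trans
    (Finset.expect_const (univ_nonempty (α := Ω)) (1 : ℝ))
  by_cases hA : A ω <;> simp [hA]

lemma pr_markov (f : Ω → ℝ) (hf : ∀ ω, 0 ≤ f ω) (t : ℝ) :
    pr (fun ω => t ≤ f ω) * t ≤ 𝔼 ω, f ω := by
  rw [pr, Finset.expect_mul]
  refine Finset.expect_le_expect fun ω _ => ?_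
  split_ifs with h
  · simpa using h
  · simpa using hf ω

/-- The probability of an event on a product is the average of the fibre probabilities. -/
lemma pr_prod_eq_expect (A : Ω × Ω' → Prop) : pr A = 𝔼 ω, pr (fun ω' => A (ω, ω')) := by
  simp only [pr]
  rw [← Finset.univ_product_univ, Finset.expect_product]

lemma pr_prod_le {A : Ω × Ω' → Prop} {c : ℝ} (hc : 0 ≤ c)
    (h : ∀ ω, pr (fun ω' => A (ω, ω')) ≤ c) : pr A ≤ c := by
  rw [pr_prod_eq_expect]
  rcases isEmpty_or_nonempty Ω with hΩ | hΩ
  · simpa [Finset.univ_eq_empty] using hc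
  · exact Finset.expect_le univ_nonempty fun ω _ => h ω

lemma pr_swap (A : Ω × Ω' → Prop) : pr A = pr (fun q : Ω' × Ω => A (q.2, q.1)) :=
  (pr_equiv (Equiv.prodComm Ω' Ω) A).symm

end Probability

section Coincidence
variable {α : Type*} [Fintype α] [DecidableEq α] {ι : Type*} [Fintype ι]

/-- A finite system of trajectories, each non-root vertex being the image of an earlier vertex
under one of two permutations. -/
structure PathSystem (ι α : Type*) where
  root : ι → Prop
  lab : ι → Bool
  src : ι → ι
  rank : ι → ℕ
  pos : (Bool → Perm α) → ι → α
  rank_src : ∀ i, ¬ root i → rank (src i) < rank i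
  pos_root : ∀ i, root i → ∀ p q, pos p i = pos q i
  pos_step : ∀ i, ¬ root i → ∀ p, pos p i = p (lab i) (pos p (src i))

namespace PathSystem
variable (S : PathSystem ι α)

/-- The step to `i` is free: no earlier step uses the same letter at the same vertex. -/
def Free (p : Bool → Perm α) (i : ι) : Prop :=
  ¬ S.root i ∧ ∀ j, ¬ S.root j → S.rank j < S.rank i → S.lab j = S.lab i →
    S.pos p (S.src j) ≠ S.pos p (S.src i)

/-- The free step to `i` arrives at the earlier vertex `j`. -/
def Coin (p : Bool → Perm α) (i j : ι) : Prop :=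
  S.Free p i ∧ S.rank j < S.rank i ∧ S.pos p j = S.pos p i

/-- The event `Q` depends only on the vertices of rank less than `r`. -/
def DependsBelow (r : ℕ) (Q : (Bool → Perm α) → Prop) : Prop :=
  ∀ p q, (∀ l, S.rank l < r → S.pos p l = S.pos q l) → Q p → Q q

lemma dependsBelow_coin {i j : ι} {r : ℕ} (h : S.rank i < r) :
    S.DependsBelow r (fun p => S.Coin p i j) := by
  rintro p q hpq ⟨⟨hr, hf⟩, hji, hv⟩
  refine ⟨⟨hr, fun l hl hli hlab => ?_⟩, hji, ?_⟩
  · rw [← hpq _ (by have := S.rank_src l hl; omega), ← hpq _ (by have := S.rank_src i hr; omega)]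
    exact hf l hl hli hlab
  · rw [← hpq _ h, ← hpq _ (by omega), hv]

lemma DependsBelow.and {r : ℕ} {Q R : (Bool → Perm α) → Prop} (hQ : S.DependsBelow r Q)
    (hR : S.DependsBelow r R) : S.DependsBelow r (fun p => Q p ∧ R p) :=
  fun p q h hp => ⟨hQ p q h hp.1, hR p q h hp.2⟩

/-- The resampled pair, in which the step to `i` is redirected to `y`. -/
noncomputable def redirect (i : ι) (p : Bool → Perm α) (y : α) : Bool → Perm α :=
  Function.update p (S.lab i) (swap (S.pos p i) y * p (S.lab i))

variable {S}

lemma redirect_pos_below {i : ι} {p : Bool → Perm α} {y : α} (hf : S.Free p i)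
    (hy : ∀ l, S.rank l < S.rank i → S.pos p l ≠ y) :
    ∀ l, S.rank l < S.rank i → S.pos (S.redirect i p y) l = S.pos p l := by
  suffices H : ∀ r l, S.rank l = r → S.rank l < S.rank i →
      S.pos (S.redirect i p y) l = S.pos p l from fun l hl => H _ l rfl hl
  intro r
  induction r using Nat.strong_induction_on with
  | _ r ih =>
    intro l hr hl
    by_cases hroot : S.root l
    · exact S.pos_root l hroot _ _
    have hs := S.rank_src l hroot
    rw [S.pos_step l hroot, ih _ (by omega) (S.src l) rfl (by omega), redirect]
    by_cases hlab : S.lab l = S.lab i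
    · rw [hlab, Function.update_self, Perm.mul_apply, ← hlab, ← S.pos_step l hroot]
      refine swap_apply_of_ne_of_ne ?_ (hy l hl)
      rw [S.pos_step l hroot, S.pos_step i hf.1, hlab]
      exact fun h => hf.2 l hroot hl hlab ((p _).injective h)
    · rw [Function.update_of_ne hlab, ← S.pos_step l hroot]

lemma redirect_pos_self {i : ι} {p : Bool → Perm α} {y : α} (hf : S.Free p i)
    (hy : ∀ l, S.rank l < S.rank i → S.pos p l ≠ y) :
    S.pos (S.redirect i p y) i = y := by
  rw [S.pos_step i hf.1, redirect_pos_below hf hy _ (S.rank_src i hf.1), redirect,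
    Function.update_self, Perm.mul_apply, ← S.pos_step i hf.1, swap_apply_left]

variable (S)

lemma pr_coin_mul_le {i j : ι} {Q : (Bool → Perm α) → Prop} (hQ : S.DependsBelow (S.rank i) Q) :
    pr (fun p => Q p ∧ S.Coin p i j) * ((Fintype.card α : ℝ) - Fintype.card ι) ≤ pr Q := by
  set Y : (Bool → Perm α) → Finset α := fun p =>
    univ \ ((univ.filter fun l => S.rank l < S.rank i).image (S.pos p)) with hYdef
  have hY : ∀ p y, y ∈ Y p → ∀ l, S.rank l < S.rank i → S.pos p l ≠ y := by
    intro p y hy l hl h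
    simp only [hYdef, mem_sdiff, mem_univ, true_and, mem_image, mem_filter, not_exists,
      not_and] at hy
    exact hy l hl h
  have hcard : ∀ p, (Fintype.card α : ℝ) - Fintype.card ι ≤ ((Y p).card : ℝ) := by
    intro p
    have h1 : (Y p).card + Fintype.card ι ≥ Fintype.card α := by
      rw [hYdef]
      have h2 := Finset.card_image_le (s := univ.filter fun l => S.rank l < S.rank i)
        (f := S.pos p)
      have h3 := Finset.card_le_univ (univ.filter fun l => S.rank l < S.rank i)
      have h4 := Finset.le_card_sdiff ((univ.filter fun l => S.rank l < S.rank i).image (S.pos p))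
        (univ : Finset α)
      rw [Finset.card_univ] at h4
      dsimp only
      omega
    have : ((Fintype.card α : ℕ) : ℝ) ≤ ((Y p).card : ℝ) + Fintype.card ι := by exact_mod_cast h1
    linarith
  have hinj : ((univ.filter fun p => Q p ∧ S.Coin p i j).sigma Y).card ≤ (univ.filter Q).card := by
    refine Finset.card_le_card_of_injOn (fun x => S.redirect i x.1 x.2) ?_ ?_
    · rintro ⟨p, y⟩ hx
      simp only [coe_sigma, Set.mem_sigma_iff, mem_coe, mem_filter, mem_univ, true_and] at hx ⊢
      exact hQ p _ (fun l hl => (redirect_pos_below hx.1.2.1 (hY p y hx.2) l hl).symm) hx.1.1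
    · rintro ⟨p, y⟩ hx ⟨q, z⟩ hz h
      simp only [coe_sigma, Set.mem_sigma_iff, mem_coe, mem_filter, mem_univ, true_and] at hx hz h
      obtain ⟨⟨-, hf, hji, hv⟩, hy⟩ := hx
      obtain ⟨⟨-, hf', -, hv'⟩, hy'⟩ := hz
      have e1 := redirect_pos_self hf (hY p y hy)
      have e2 := redirect_pos_self hf' (hY q z hy')
      have e3 := redirect_pos_below hf (hY p y hy) j hji
      have e4 := redirect_pos_below hf' (hY q z hy') j hji
      have hyz : y = z := by rw [← e1, ← e2, h]
      have hpq : S.pos p i = S.pos q i := by rw [← hv, ← hv', ← e3, ← e4, h]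
      subst hyz
      have : p = q := by
        funext b
        by_cases hb : b = S.lab i
        · subst hb
          have := congrFun h (S.lab i)
          rw [redirect, redirect, Function.update_self, Function.update_self, hpq] at this
          exact mul_left_cancel this
        · have := congrFun h b
          rwa [redirect, redirect, Function.update_of_ne hb, Function.update_of_ne hb] at this
      subst this
      rfl
  rw [pr_eq_card, pr_eq_card, div_mul_eq_mul_div]
  refine div_le_div_of_nonneg_right ?_ (by positivity)
  rw [Finset.card_sigma] at hinj
  calc _ = ∑ _p ∈ univ.filter fun p => Q p ∧ S.Coin p i j,
        ((Fintype.card α : ℝ) - Fintype.card ι) := by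
        rw [sum_const, nsmul_eq_mul]; congr!
    _ ≤ ∑ p ∈ univ.filter fun p => Q p ∧ S.Coin p i j, ((Y p).card : ℝ) :=
        Finset.sum_le_sum fun p _ => hcard p
    _ ≤ _ := by exact_mod_cast hinj

lemma pr_coin_le {i j : ι} {Q : (Bool → Perm α) → Prop} (hQ : S.DependsBelow (S.rank i) Q)
    (hn : Fintype.card ι < Fintype.card α) :
    pr (fun p => Q p ∧ S.Coin p i j) ≤ pr Q / ((Fintype.card α : ℝ) - Fintype.card ι) := by
  rw [le_div_iff₀ (by rw [sub_pos]; exact_mod_cast hn)]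
  exact S.pr_coin_mul_le hQ

lemma pr_one_coin_le (hn : Fintype.card ι < Fintype.card α) (i j : ι) :
    pr (fun p => S.Coin p i j) ≤ 1 / ((Fintype.card α : ℝ) - Fintype.card ι) := by
  have h0 : (0 : ℝ) < (Fintype.card α : ℝ) - Fintype.card ι := by
    rw [sub_pos]; exact_mod_cast hn
  have h := S.pr_coin_le (i := i) (j := j) (Q := fun _ => True) (fun _ _ _ _ => trivial) hn
  refine le_trans (pr_mono fun p hp => ⟨trivial, hp⟩) (h.trans ?_)
  gcongr
  exact pr_le_one _

lemma pr_two_coin_le (hn : Fintype.card ι < Fintype.card α) {i i' : ι} (j j' : ι)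
    (hi : S.rank i < S.rank i') :
    pr (fun p => S.Coin p i j ∧ S.Coin p i' j') ≤
      1 / ((Fintype.card α : ℝ) - Fintype.card ι) ^ 2 := by
  have h0 : (0 : ℝ) < (Fintype.card α : ℝ) - Fintype.card ι := by
    rw [sub_pos]; exact_mod_cast hn
  have h := S.pr_coin_le (i := i') (j := j') (S.dependsBelow_coin (j := j) hi) hn
  refine h.trans ?_
  rw [pow_two, ← div_div]
  gcongr
  exact S.pr_one_coin_le hn i j

lemma pr_three_coin_le (hn : Fintype.card ι < Fintype.card α) {i i' i'' : ι} (j j' j'' : ι)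
    (hi : S.rank i < S.rank i') (hi' : S.rank i' < S.rank i'') :
    pr (fun p => (S.Coin p i j ∧ S.Coin p i' j') ∧ S.Coin p i'' j'') ≤
      1 / ((Fintype.card α : ℝ) - Fintype.card ι) ^ 3 := by
  have h0 : (0 : ℝ) < (Fintype.card α : ℝ) - Fintype.card ι := by
    rw [sub_pos]; exact_mod_cast hn
  have h := S.pr_coin_le (i := i'') (j := j'')
    (DependsBelow.and S (S.dependsBelow_coin (j := j) (hi.trans hi'))
      (S.dependsBelow_coin (j := j') hi')) hn
  refine h.trans ?_
  rw [pow_succ, ← div_div]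
  gcongr
  exact S.pr_two_coin_le hn j j' hi

lemma pr_exists_coin_le (hn : Fintype.card ι < Fintype.card α) :
    pr (fun p => ∃ i j, S.Coin p i j) ≤
      (Fintype.card ι : ℝ) ^ 2 / ((Fintype.card α : ℝ) - Fintype.card ι) := by
  refine (pr_mono (B := fun p => ∃ x : ι × ι, S.Coin p x.1 x.2)
    (by rintro p ⟨i, j, h⟩; exact ⟨(i, j), h⟩)).trans ((pr_exists_le _).trans ?_)
  refine (Finset.sum_le_sum fun x _ => S.pr_one_coin_le hn x.1 x.2).trans (le_of_eq ?_)
  rw [sum_const, nsmul_eq_mul, card_univ, Fintype.card_prod]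
  push_cast; ring

lemma pr_exists_three_coin_le (hn : Fintype.card ι < Fintype.card α) :
    pr (fun p => ∃ i j i' j' i'' j'', S.rank i < S.rank i' ∧ S.rank i' < S.rank i'' ∧
      S.Coin p i j ∧ S.Coin p i' j' ∧ S.Coin p i'' j'') ≤
      (Fintype.card ι : ℝ) ^ 6 / ((Fintype.card α : ℝ) - Fintype.card ι) ^ 3 := by
  have h0 : (0 : ℝ) < (Fintype.card α : ℝ) - Fintype.card ι := by
    rw [sub_pos]; exact_mod_cast hn
  refine (pr_mono (B := fun p => ∃ x : (ι × ι × ι) × (ι × ι × ι),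
    (S.rank x.1.1 < S.rank x.1.2.1 ∧ S.rank x.1.2.1 < S.rank x.1.2.2) ∧
      (S.Coin p x.1.1 x.2.1 ∧ S.Coin p x.1.2.1 x.2.2.1) ∧ S.Coin p x.1.2.2 x.2.2.2)
    (by rintro p ⟨i, j, i', j', i'', j'', h1, h2, h3, h4, h5⟩
        exact ⟨((i, i', i''), (j, j', j'')), ⟨h1, h2⟩, ⟨h3, h4⟩, h5⟩)).trans
      ((pr_exists_le _).trans ?_)
  have : ∀ x : (ι × ι × ι) × (ι × ι × ι), pr (fun p =>
      (S.rank x.1.1 < S.rank x.1.2.1 ∧ S.rank x.1.2.1 < S.rank x.1.2.2) ∧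
      (S.Coin p x.1.1 x.2.1 ∧ S.Coin p x.1.2.1 x.2.2.1) ∧ S.Coin p x.1.2.2 x.2.2.2) ≤
      1 / ((Fintype.card α : ℝ) - Fintype.card ι) ^ 3 := by
    intro x
    by_cases h : S.rank x.1.1 < S.rank x.1.2.1 ∧ S.rank x.1.2.1 < S.rank x.1.2.2
    · exact (pr_mono fun p hp => hp.2).trans (S.pr_three_coin_le hn _ _ _ h.1 h.2)
    · calc _ ≤ (0 : ℝ) := by simp [pr, h]
        _ ≤ _ := by positivity
  refine (Finset.sum_le_sum fun x _ => this x).trans (le_of_eq ?_)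
  rw [sum_const, nsmul_eq_mul, card_univ]
  simp only [Fintype.card_prod]
  push_cast; ring

end PathSystem
end Coincidence

section Walks
variable {α : Type*} [Fintype α] [DecidableEq α]

/-- The position after `j` steps of the walk from `x` along the letters `u 0, u 1, …`. -/
def walk (p : Bool → Perm α) (u : ℕ → Bool) (x : α) : ℕ → α
  | 0 => x
  | j + 1 => p (u j) (walk p u x j)

/-- The vertices of the four walks from `x false` and `x true` along two words. -/
def quadSystem (ℓ : ℕ) (u : Bool → ℕ → Bool) (x : Bool → α) :
    PathSystem (Bool × Bool × Fin (ℓ + 1)) α where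
  root i := i.2.2.val = 0
  lab i := u i.2.1 (i.2.2.val - 1)
  src i := (i.1, i.2.1, ⟨i.2.2.val - 1, by omega⟩)
  rank i := if i.2.2.val = 0 then 0 else (2 * i.1.toNat + i.2.1.toNat) * ℓ + i.2.2.val
  pos p i := walk p (u i.2.1) (x i.1) i.2.2.val
  rank_src := by
    rintro ⟨b, c, j, hj⟩ h
    simp only at h ⊢
    split_ifs <;> omega
  pos_root := by
    rintro ⟨b, c, j, hj⟩ h p q
    simp only at h
    subst h
    rfl
  pos_step := by
    rintro ⟨b, c, j, hj⟩ h p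
    simp only at h ⊢
    obtain ⟨k, rfl⟩ := Nat.exists_eq_succ_of_ne_zero h
    rfl

lemma quadSystem_rank_injOn {ℓ : ℕ} {u : Bool → ℕ → Bool} {x : Bool → α}
    {i i' : Bool × Bool × Fin (ℓ + 1)} (hi : ¬ (quadSystem ℓ u x).root i)
    (hi' : ¬ (quadSystem ℓ u x).root i')
    (h : (quadSystem ℓ u x).rank i = (quadSystem ℓ u x).rank i') : i = i' := by
  obtain ⟨b, c, j, hj⟩ := i
  obtain ⟨b', c', j', hj'⟩ := i'
  simp only [quadSystem] at hi hi' h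
  rw [if_neg hi, if_neg hi'] at h
  cases b <;> cases c <;> cases b' <;> cases c' <;>
    simp only [Bool.toNat_true, Bool.toNat_false, Prod.mk.injEq, Fin.mk.injEq, true_and,
      reduceCtorEq, false_and, and_false] at h ⊢ <;> omega

section Quad
variable {ℓ : ℕ} {u : Bool → ℕ → Bool} {x : Bool → α} {p : Bool → Perm α}

/-- The labelled edges traversed by the four walks. -/
noncomputable def quadEdges (ℓ : ℕ) (u : Bool → ℕ → Bool) (x : Bool → α) (p : Bool → Perm α) :
    Finset (Bool × α) :=
  univ.image fun i : Bool × Bool × Fin ℓ => (u i.2.1 i.2.2.val, walk p (u i.2.1) (x i.1) i.2.2.val)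

/-- The points visited by the four walks. -/
noncomputable def quadVerts (ℓ : ℕ) (u : Bool → ℕ → Bool) (x : Bool → α) (p : Bool → Perm α) :
    Finset α :=
  univ.image fun i : Bool × Bool × Fin (ℓ + 1) => walk p (u i.2.1) (x i.1) i.2.2.val

lemma mem_quadEdges {b c : Bool} {j : ℕ} (hj : j < ℓ) :
    (u c j, walk p (u c) (x b) j) ∈ quadEdges ℓ u x p :=
  mem_image.2 ⟨(b, c, ⟨j, hj⟩), mem_univ _, rfl⟩

lemma mem_quadVerts {b c : Bool} {j : ℕ} (hj : j ≤ ℓ) :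
    walk p (u c) (x b) j ∈ quadVerts ℓ u x p :=
  mem_image.2 ⟨(b, c, ⟨j, by omega⟩), mem_univ _, rfl⟩

/-- The edges leaving `v`. -/
noncomputable def outEdges (ℓ : ℕ) (u : Bool → ℕ → Bool) (x : Bool → α) (p : Bool → Perm α)
    (v : α) : Finset (Bool × α) := (quadEdges ℓ u x p).filter fun e => e.2 = v

/-- The edges arriving at `v`. -/
noncomputable def inEdges (ℓ : ℕ) (u : Bool → ℕ → Bool) (x : Bool → α) (p : Bool → Perm α)
    (v : α) : Finset (Bool × α) := (quadEdges ℓ u x p).filter fun e => p e.1 e.2 = v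

lemma mem_outEdges {b c : Bool} {j : ℕ} (hj : j < ℓ) :
    (u c j, walk p (u c) (x b) j) ∈ outEdges ℓ u x p (walk p (u c) (x b) j) :=
  mem_filter.2 ⟨mem_quadEdges hj, rfl⟩

lemma mem_inEdges {b c : Bool} {j : ℕ} (hj : j < ℓ) :
    (u c j, walk p (u c) (x b) j) ∈ inEdges ℓ u x p (walk p (u c) (x b) (j + 1)) :=
  mem_filter.2 ⟨mem_quadEdges hj, rfl⟩

lemma sum_out_add_in :
    ∑ v ∈ quadVerts ℓ u x p, ((outEdges ℓ u x p v).card + (inEdges ℓ u x p v).card) =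
      2 * (quadEdges ℓ u x p).card := by
  have h1 := Finset.card_eq_sum_card_fiberwise (f := fun e : Bool × α => e.2)
    (s := quadEdges ℓ u x p) (t := quadVerts ℓ u x p) (by
      intro e he
      obtain ⟨⟨b, c, j⟩, -, rfl⟩ := mem_image.1 he
      exact mem_quadVerts j.2.le)
  have h2 := Finset.card_eq_sum_card_fiberwise (f := fun e : Bool × α => p e.1 e.2)
    (s := quadEdges ℓ u x p) (t := quadVerts ℓ u x p) (by
      intro e he
      obtain ⟨⟨b, c, j⟩, -, rfl⟩ := mem_image.1 he
      exact mem_quadVerts (j := j + 1) j.2)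
  rw [sum_add_distrib, two_mul]
  unfold outEdges inEdges
  rw [← h1, ← h2]

lemma out_eq_two (hℓ : 1 ≤ ℓ) (h0 : u false 0 ≠ u true 0) (b : Bool) :
    2 ≤ (outEdges ℓ u x p (x b)).card := by
  have h1 := mem_outEdges (x := x) (p := p) (u := u) (b := b) (c := false) (j := 0) hℓ
  have h2 := mem_outEdges (x := x) (p := p) (u := u) (b := b) (c := true) (j := 0) hℓ
  exact Finset.one_lt_card.2 ⟨_, h1, _, h2, fun h => h0 (congrArg Prod.fst h)⟩

lemma in_eq_two (hℓ : 1 ≤ ℓ) (h1 : u false (ℓ - 1) ≠ u true (ℓ - 1))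
    (hev : ∀ b, walk p (u false) (x b) ℓ = walk p (u true) (x b) ℓ) (b c : Bool) :
    2 ≤ (inEdges ℓ u x p (walk p (u c) (x b) ℓ)).card := by
  obtain ⟨k, rfl⟩ : ∃ k, ℓ = k + 1 := ⟨ℓ - 1, by omega⟩
  have e1 := mem_inEdges (ℓ := k + 1) (x := x) (p := p) (u := u) (b := b) (c := false) (j := k)
    (by omega)
  have e2 := mem_inEdges (ℓ := k + 1) (x := x) (p := p) (u := u) (b := b) (c := true) (j := k)
    (by omega)
  rw [hev b] at e1
  have : walk p (u c) (x b) (k + 1) = walk p (u true) (x b) (k + 1) := by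
    cases c
    · exact hev b
    · rfl
  rw [this]
  exact Finset.one_lt_card.2 ⟨_, e1, _, e2, fun h => h1 (congrArg Prod.fst h)⟩

lemma two_le_deg (hℓ : 1 ≤ ℓ) (h0 : u false 0 ≠ u true 0)
    (h1 : u false (ℓ - 1) ≠ u true (ℓ - 1))
    (hev : ∀ b, walk p (u false) (x b) ℓ = walk p (u true) (x b) ℓ) (v : α)
    (hv : v ∈ quadVerts ℓ u x p) :
    2 ≤ (outEdges ℓ u x p v).card + (inEdges ℓ u x p v).card := by
  obtain ⟨⟨b, c, j, hj⟩, -, rfl⟩ := mem_image.1 hv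
  dsimp only
  rcases Nat.eq_zero_or_pos j with rfl | hj0
  · exact le_add_right (out_eq_two hℓ h0 b)
  rcases eq_or_lt_of_le (Nat.lt_succ_iff.1 hj) with rfl | hjl
  · exact le_add_left (in_eq_two hℓ h1 hev b c)
  · have e1 := card_pos.2 ⟨_, mem_outEdges (x := x) (p := p) (u := u) (b := b) (c := c) hjl⟩
    obtain ⟨k, rfl⟩ : ∃ k, j = k + 1 := ⟨j - 1, by omega⟩
    have e2 := card_pos.2 ⟨_, mem_inEdges (ℓ := ℓ) (x := x) (p := p) (u := u) (b := b) (c := c)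
      (j := k) (by omega)⟩
    omega

lemma deg_eq_two (hℓ : 1 ≤ ℓ) (h0 : u false 0 ≠ u true 0)
    (h1 : u false (ℓ - 1) ≠ u true (ℓ - 1))
    (hev : ∀ b, walk p (u false) (x b) ℓ = walk p (u true) (x b) ℓ)
    (hE : (quadEdges ℓ u x p).card ≤ (quadVerts ℓ u x p).card) (v : α)
    (hv : v ∈ quadVerts ℓ u x p) :
    (outEdges ℓ u x p v).card + (inEdges ℓ u x p v).card = 2 := by
  by_contra hne
  have hlt : 2 < (outEdges ℓ u x p v).card + (inEdges ℓ u x p v).card :=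
    lt_of_le_of_ne (two_le_deg hℓ h0 h1 hev v hv) (Ne.symm hne)
  have := Finset.sum_lt_sum (s := quadVerts ℓ u x p) (f := fun _ => 2)
    (fun v hv => two_le_deg hℓ h0 h1 hev v hv) ⟨v, hv, hlt⟩
  rw [sum_out_add_in, sum_const, smul_eq_mul] at this
  omega

lemma walk_eq_walk (hx : x false ≠ x true) (h0 : u false 0 ≠ u true 0)
    (hℓ : 1 ≤ ℓ) (hdeg : ∀ v ∈ quadVerts ℓ u x p,
      (outEdges ℓ u x p v).card + (inEdges ℓ u x p v).card = 2) :
    ∀ j < ℓ, ∀ j' < ℓ, ∀ b c b' c', walk p (u c) (x b) j = walk p (u c') (x b') j' →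
      j = j' ∧ b = b' ∧ (j = 0 ∨ c = c') := by
  have hin0 : ∀ b, (inEdges ℓ u x p (x b)) = ∅ := by
    intro b
    have e1 := out_eq_two (p := p) (x := x) hℓ h0 b
    have e2 := hdeg _ (mem_quadVerts (p := p) (x := x) (u := u) (b := b) (c := true)
      (Nat.zero_le ℓ))
    rw [show walk p (u true) (x b) 0 = x b from rfl] at e2
    exact card_eq_zero.1 (by omega)
  have hne : ∀ j < ℓ, ∀ b c b', x b' ≠ walk p (u c) (x b) (j + 1) := by
    intro j hj b c b' h
    have := mem_inEdges (x := x) (p := p) (u := u) (b := b) (c := c) hj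
    rw [← h, hin0] at this
    simp at this
  have hu : ∀ c c', u c 0 = u c' 0 → c = c' := by
    intro c c' h
    cases c <;> cases c' <;> first | rfl | exact absurd h h0 | exact absurd h.symm h0
  intro j
  induction j with
  | zero =>
    intro _ j' hj' b c b' c' h
    rcases j' with _ | j'
    · refine ⟨rfl, ?_, Or.inl rfl⟩
      change x b = x b' at h
      cases b <;> cases b' <;> first | rfl | exact absurd h hx | exact absurd h.symm hx
    · exact absurd h (hne j' (by omega) _ _ _)
  | succ j ih =>
    intro hj j' hj' b c b' c' h
    rcases j' with _ | j'
    · exact absurd h.symm (hne j (by omega) _ _ _)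
    · have e1 := mem_inEdges (ℓ := ℓ) (x := x) (p := p) (u := u) (b := b) (c := c) (j := j)
        (by omega)
      have e2 := mem_inEdges (ℓ := ℓ) (x := x) (p := p) (u := u) (b := b') (c := c') (j := j')
        (by omega)
      rw [← h] at e2
      have e3 := card_pos.2 ⟨_, mem_outEdges (x := x) (p := p) (u := u) (b := b) (c := c) hj⟩
      have e4 := hdeg _ (mem_quadVerts (p := p) (x := x) (u := u) (b := b) (c := c) hj.le)
      have e5 := Finset.card_le_one.1 (show (inEdges ℓ u x p _).card ≤ 1 by omega) _ e1 _ e2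
      rw [Prod.mk.injEq] at e5
      obtain ⟨hj1, hb, hc⟩ := ih (by omega) j' (by omega) b c b' c' e5.2
      refine ⟨by omega, hb, Or.inr ?_⟩
      rcases hc with hc | hc
      · subst hc
        subst hj1
        exact hu _ _ e5.1
      · exact hc

lemma two_coin_of_deg (hx : x false ≠ x true) (hℓ : 1 ≤ ℓ) (h0 : u false 0 ≠ u true 0)
    (hev : ∀ b, walk p (u false) (x b) ℓ = walk p (u true) (x b) ℓ)
    (hdeg : ∀ v ∈ quadVerts ℓ u x p,
      (outEdges ℓ u x p v).card + (inEdges ℓ u x p v).card = 2) (b : Bool) :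
    (quadSystem ℓ u x).Coin p (b, true, Fin.last ℓ) (b, false, Fin.last ℓ) := by
  refine ⟨⟨?_, ?_⟩, ?_, hev b⟩
  · simp only [quadSystem, Fin.val_last]; omega
  · rintro ⟨b', c', j', hj'⟩ hr hlt hlab hsrc
    simp only [quadSystem, Fin.val_last] at hr hlt hlab hsrc
    obtain ⟨h1, h2, h3⟩ := walk_eq_walk hx h0 hℓ hdeg _ (by omega) _ (by omega) _ _ _ _ hsrc
    subst h2
    obtain rfl : j' = ℓ := by omega
    have hc : c' = true := by
      rcases h3 with h3 | h3
      · rw [h3] at hlab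
        cases c'
        · exact absurd hlab h0
        · rfl
      · exact h3
    subst hc
    exact lt_irrefl _ hlt
  · simp only [quadSystem, Fin.val_last]
    rw [if_neg (by omega), if_neg (by omega)]
    simp only [Bool.toNat_true, Bool.toNat_false]
    have : (2 * b.toNat + 1) * ℓ = (2 * b.toNat + 0) * ℓ + ℓ := by ring
    omega

lemma card_edges_le_free :
    (quadEdges ℓ u x p).card ≤
      (univ.filter fun i => (quadSystem ℓ u x).Free p i).card := by
  set S := quadSystem ℓ u x
  refine Finset.card_le_card_of_surjOn (fun i => (S.lab i, S.pos p (S.src i))) ?_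
  intro e he
  obtain ⟨⟨b, c, j⟩, -, rfl⟩ := mem_image.1 he
  set P : (Bool × Bool × Fin (ℓ + 1)) → Prop := fun i => ¬ S.root i ∧
    (S.lab i, S.pos p (S.src i)) = (u c j, walk p (u c) (x b) j)
  have hne : (univ.filter P).Nonempty := by
    refine ⟨(b, c, j.succ), mem_filter.2 ⟨mem_univ _, ?_, ?_⟩⟩
    · simp [S, quadSystem]
    · simp [S, quadSystem]
  obtain ⟨i, hi, hmin⟩ := Finset.exists_min_image (univ.filter P) S.rank hne
  obtain ⟨-, hi1, hi2⟩ := mem_filter.1 hi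
  refine ⟨i, ?_, hi2⟩
  simp only [coe_filter, mem_univ, true_and, Set.mem_ofPred_eq]
  refine ⟨hi1, fun k hk hlt hlab hpos => ?_⟩
  have := hmin k (mem_filter.2 ⟨mem_univ _, hk, by rw [hlab, hpos, hi2]⟩)
  omega

lemma card_free_noncoin_le (hx : x false ≠ x true) :
    (univ.filter fun i => (quadSystem ℓ u x).Free p i ∧
      ¬ ∃ j, (quadSystem ℓ u x).Coin p i j).card + 2 ≤ (quadVerts ℓ u x p).card := by
  set S := quadSystem ℓ u x
  set F := univ.filter fun i => S.Free p i ∧ ¬ ∃ j, S.Coin p i j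
  have hF : ∀ i ∈ F, S.Free p i ∧ ∀ j, S.rank j < S.rank i → S.pos p j ≠ S.pos p i := by
    intro i hi
    obtain ⟨-, h1, h2⟩ := mem_filter.1 hi
    exact ⟨h1, fun j hj h => h2 ⟨j, h1, hj, h⟩⟩
  have hroot : ∀ i ∈ F, ∀ b, x b ≠ S.pos p i := by
    intro i hi b
    refine (hF i hi).2 (b, true, 0) ?_
    have := S.rank_src i (hF i hi).1.1
    simp only [S, quadSystem, Fin.val_zero, if_true] at this ⊢
    omega
  have hinj : Set.InjOn (S.pos p) F := by
    intro i hi i' hi' h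
    rcases lt_trichotomy (S.rank i) (S.rank i') with h1 | h1 | h1
    · exact absurd h ((hF i' hi').2 i h1)
    · exact quadSystem_rank_injOn (hF i hi).1.1 (hF i' hi').1.1 h1
    · exact absurd h.symm ((hF i hi).2 i' h1)
  rw [← Finset.card_image_of_injOn hinj, ← Finset.card_pair hx, ← Finset.card_union_of_disjoint]
  · refine Finset.card_le_card (Finset.union_subset ?_ ?_)
    · rintro v hv
      obtain ⟨⟨b, c, j⟩, -, rfl⟩ := mem_image.1 hv
      exact mem_quadVerts (Nat.lt_succ_iff.1 j.2)
    · intro v hv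
      rw [mem_insert, mem_singleton] at hv
      rcases hv with rfl | rfl
      · exact mem_quadVerts (b := false) (c := true) (Nat.zero_le ℓ)
      · exact mem_quadVerts (b := true) (c := true) (Nat.zero_le ℓ)
  · rw [Finset.disjoint_right]
    intro v hv hv'
    obtain ⟨i, hi, rfl⟩ := mem_image.1 hv'
    rw [mem_insert, mem_singleton] at hv
    rcases hv with hv | hv <;> exact hroot i hi _ hv.symm

lemma three_coin_of_card (hx : x false ≠ x true)
    (hE : (quadVerts ℓ u x p).card < (quadEdges ℓ u x p).card) :
    ∃ i j i' j' i'' j'', (quadSystem ℓ u x).rank i < (quadSystem ℓ u x).rank i' ∧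
      (quadSystem ℓ u x).rank i' < (quadSystem ℓ u x).rank i'' ∧
      (quadSystem ℓ u x).Coin p i j ∧ (quadSystem ℓ u x).Coin p i' j' ∧
      (quadSystem ℓ u x).Coin p i'' j'' := by
  have h1 := card_edges_le_free (ℓ := ℓ) (u := u) (x := x) (p := p)
  have h2 := card_free_noncoin_le (ℓ := ℓ) (u := u) (p := p) hx
  set S := quadSystem ℓ u x
  have h3 := Finset.card_filter_add_card_filter_not (s := univ.filter fun i => S.Free p i)
    (fun i => ∃ j, S.Coin p i j)
  rw [Finset.filter_filter, Finset.filter_filter] at h3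
  have h4 : 2 < (univ.filter fun i => S.Free p i ∧ ∃ j, S.Coin p i j).card := by
    have e : (univ.filter fun i => S.Free p i ∧ ¬ ∃ j, S.Coin p i j).card + 2 <
      (univ.filter fun i => S.Free p i).card := by omega
    omega
  obtain ⟨a, ha, b, hb, c, hc, hab, hac, hbc⟩ := Finset.two_lt_card.1 h4
  simp only [mem_filter, mem_univ, true_and] at ha hb hc
  obtain ⟨hfa, ja, ha⟩ := ha
  obtain ⟨hfb, jb, hb⟩ := hb
  obtain ⟨hfc, jc, hc⟩ := hc
  have rab : S.rank a ≠ S.rank b := fun h => hab (quadSystem_rank_injOn hfa.1 hfb.1 h)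
  have rac : S.rank a ≠ S.rank c := fun h => hac (quadSystem_rank_injOn hfa.1 hfc.1 h)
  have rbc : S.rank b ≠ S.rank c := fun h => hbc (quadSystem_rank_injOn hfb.1 hfc.1 h)
  rcases lt_or_gt_of_ne rab with h | h <;> rcases lt_or_gt_of_ne rac with h' | h' <;>
    rcases lt_or_gt_of_ne rbc with h'' | h''
  · exact ⟨a, ja, b, jb, c, jc, h, h'', ha, hb, hc⟩
  · exact ⟨a, ja, c, jc, b, jb, h', h'', ha, hc, hb⟩
  · omega
  · exact ⟨c, jc, a, ja, b, jb, h', h, hc, ha, hb⟩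
  · exact ⟨b, jb, a, ja, c, jc, h, h', hb, ha, hc⟩
  · omega
  · exact ⟨b, jb, c, jc, a, ja, h'', h', hb, hc, ha⟩
  · exact ⟨c, jc, b, jb, a, ja, h'', h, hc, hb, ha⟩

end Quad

lemma pr_walk_collision_le {ℓ : ℕ} {u : Bool → ℕ → Bool} {x : Bool → α} (hx : x false ≠ x true)
    (hℓ : 1 ≤ ℓ) (h0 : u false 0 ≠ u true 0) (h1 : u false (ℓ - 1) ≠ u true (ℓ - 1))
    (hn : 4 * (ℓ + 1) < Fintype.card α) :
    pr (fun p : Bool → Perm α => ∀ b, walk p (u false) (x b) ℓ = walk p (u true) (x b) ℓ) ≤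
      1 / ((Fintype.card α : ℝ) - (4 * (ℓ + 1) : ℕ)) ^ 2 +
        ((4 * (ℓ + 1) : ℕ) : ℝ) ^ 6 / ((Fintype.card α : ℝ) - (4 * (ℓ + 1) : ℕ)) ^ 3 := by
  have hι : Fintype.card (Bool × Bool × Fin (ℓ + 1)) = 4 * (ℓ + 1) := by
    simp only [Fintype.card_prod, Fintype.card_bool, Fintype.card_fin]; ring
  rw [← hι] at hn ⊢
  refine le_trans (pr_mono (B := fun p =>
    ((quadSystem ℓ u x).Coin p (false, true, Fin.last ℓ) (false, false, Fin.last ℓ) ∧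
      (quadSystem ℓ u x).Coin p (true, true, Fin.last ℓ) (true, false, Fin.last ℓ)) ∨
    ∃ i j i' j' i'' j'', (quadSystem ℓ u x).rank i < (quadSystem ℓ u x).rank i' ∧
      (quadSystem ℓ u x).rank i' < (quadSystem ℓ u x).rank i'' ∧
      (quadSystem ℓ u x).Coin p i j ∧ (quadSystem ℓ u x).Coin p i' j' ∧
      (quadSystem ℓ u x).Coin p i'' j'') ?_) ((pr_or_le _ _).trans (add_le_add ?_ ?_))
  · intro p hev
    rcases le_or_gt (quadEdges ℓ u x p).card (quadVerts ℓ u x p).card with hE | hE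
    · left
      have hdeg := deg_eq_two hℓ h0 h1 hev hE
      exact ⟨two_coin_of_deg hx hℓ h0 hev hdeg false, two_coin_of_deg hx hℓ h0 hev hdeg true⟩
    · right
      exact three_coin_of_card hx hE
  · refine (quadSystem ℓ u x).pr_two_coin_le hn _ _ ?_
    simp only [quadSystem, Fin.val_last, Bool.toNat_true, Bool.toNat_false]
    rw [if_neg (by omega), if_neg (by omega)]
    omega
  · exact (quadSystem ℓ u x).pr_exists_three_coin_le hn

end Walks

section Words
variable {α : Type*}

/-- The permutation `σ` is a product of at most `ℓ` of the two permutations and their inverses. -/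
def WL (p : Bool → Perm α) (ℓ : ℕ) (σ : Perm α) : Prop :=
  ∃ l : List (Perm α), (∀ s ∈ l, s = p false ∨ s = p true ∨ s = (p false)⁻¹ ∨ s = (p true)⁻¹) ∧
    l.prod = σ ∧ l.length ≤ ℓ

variable {p : Bool → Perm α}

lemma WL.mono {ℓ ℓ' : ℕ} {σ : Perm α} (h : WL p ℓ σ) (hl : ℓ ≤ ℓ') : WL p ℓ' σ := by
  obtain ⟨l, h1, h2, h3⟩ := h
  exact ⟨l, h1, h2, h3.trans hl⟩

lemma WL.one : WL p 0 1 := ⟨[], by simp⟩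

lemma WL.letter (b : Bool) : WL p 1 (p b) :=
  ⟨[p b], by cases b <;> simp⟩

lemma WL.mul {ℓ ℓ' : ℕ} {σ τ : Perm α} (h : WL p ℓ σ) (h' : WL p ℓ' τ) :
    WL p (ℓ + ℓ') (σ * τ) := by
  obtain ⟨l, h1, h2, h3⟩ := h
  obtain ⟨l', h1', h2', h3'⟩ := h'
  refine ⟨l ++ l', ?_, by rw [List.prod_append, h2, h2'], by rw [List.length_append]; omega⟩
  intro s hs
  rcases List.mem_append.1 hs with hs | hs
  · exact h1 s hs
  · exact h1' s hs

lemma WL.inv {ℓ : ℕ} {σ : Perm α} (h : WL p ℓ σ) : WL p ℓ σ⁻¹ := by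
  obtain ⟨l, h1, h2, h3⟩ := h
  refine ⟨(l.map fun s => s⁻¹).reverse, ?_, by rw [← List.prod_inv_reverse, h2], by simpa using h3⟩
  intro s hs
  simp only [List.mem_reverse, List.mem_map] at hs
  obtain ⟨t, ht, rfl⟩ := hs
  rcases h1 t ht with rfl | rfl | rfl | rfl <;> simp

lemma WL.conj {ℓ k : ℕ} {σ τ : Perm α} (h : WL p ℓ σ) (h' : WL p k τ) :
    WL p (ℓ + 2 * k) (τ * σ * τ⁻¹) :=
  ((h'.mul h).mul h'.inv).mono (by omega)

lemma WL.pow {ℓ : ℕ} {σ : Perm α} (h : WL p ℓ σ) (k : ℕ) : WL p (ℓ * k) (σ ^ k) := by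
  induction k with
  | zero => exact WL.one.mono (Nat.zero_le _)
  | succ k ih => rw [pow_succ]; exact (ih.mul h).mono (by rw [Nat.mul_succ])

lemma WL.list_prod {ℓ : ℕ} {l : List (Perm α)} (h : ∀ σ ∈ l, WL p ℓ σ) :
    WL p (ℓ * l.length) l.prod := by
  induction l with
  | nil => exact WL.one
  | cons a t ih =>
    rw [List.prod_cons, List.length_cons]
    exact ((h a (by simp)).mul (ih fun σ hσ => h σ (by simp [hσ]))).mono
      (by rw [Nat.mul_succ]; omega)

/-- The value of a positive word. -/
def ev (p : Bool → Perm α) (l : List Bool) : Perm α := (l.map p).prod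

lemma ev_append (l l' : List Bool) : ev p (l ++ l') = ev p l * ev p l' := by
  simp [ev]

lemma WL.ev (l : List Bool) : WL p l.length (ev p l) := by
  have := WL.list_prod (p := p) (ℓ := 1) (l := l.map p) (by
    intro σ hσ
    obtain ⟨b, -, rfl⟩ := List.mem_map.1 hσ
    exact WL.letter b)
  simpa [RandGen.ev] using this

lemma walk_congr {u v : ℕ → Bool} {x : α} {j : ℕ} (h : ∀ i < j, u i = v i) :
    walk p u x j = walk p v x j := by
  induction j with
  | zero => rfl
  | succ j ih =>
    simp only [walk]
    rw [ih fun i hi => h i (by omega), h j (by omega)]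

lemma ev_eq_walk (l : List Bool) (x : α) :
    ev p l x = walk p (fun j => l.reverse.getD j false) x l.length := by
  induction l with
  | nil => simp [ev, walk]
  | cons a t ih =>
    rw [show ev p (a :: t) = p a * ev p t by simp [ev], Perm.mul_apply, ih, List.length_cons, walk]
    congr 1
    · congr 1
      simp
    · refine walk_congr fun i hi => ?_
      rw [List.reverse_cons, List.getD_append _ _ _ _ (by simpa using hi)]

lemma exists_strip_common (w w' : List Bool) (hl : w.length = w'.length) (hne : w ≠ w') :
    ∃ c a t a' t', w = c ++ a :: t ∧ w' = c ++ a' :: t' ∧ a ≠ a' ∧ t.length = t'.length := by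
  induction w generalizing w' with
  | nil => exact absurd (List.length_eq_zero_iff.1 hl.symm).symm hne
  | cons a t ih =>
    cases w' with
    | nil => simp at hl
    | cons a' t' =>
      by_cases h : a = a'
      · subst h
        obtain ⟨c, b, s, b', s', h1, h2, h3, h4⟩ := ih t' (by simpa using hl) (by simpa using hne)
        exact ⟨a :: c, b, s, b', s', by simp [h1], by simp [h2], h3, h4⟩
      · exact ⟨[], a, t, a', t', rfl, rfl, h, by simpa using hl⟩

lemma exists_strip (w w' : List Bool) (hl : w.length = w'.length) (hne : w ≠ w') :
    ∃ c s s' d, w = c ++ s ++ d ∧ w' = c ++ s' ++ d ∧ s.length = s'.length ∧ 1 ≤ s.length ∧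
      s.getD 0 false ≠ s'.getD 0 false ∧ s.reverse.getD 0 false ≠ s'.reverse.getD 0 false := by
  obtain ⟨c, a, t, a', t', rfl, rfl, ha, hlen⟩ := exists_strip_common w w' hl hne
  obtain ⟨d, b, r, b', r', h1, h2, hb, hlen'⟩ := exists_strip_common (a :: t).reverse
    (a' :: t').reverse (by simpa using hlen) (by
      intro h
      rw [List.reverse_inj, List.cons.injEq] at h
      exact ha h.1)
  have e1 : a :: t = (b :: r).reverse ++ d.reverse := by
    rw [← List.reverse_append, ← h1, List.reverse_reverse]
  have e2 : a' :: t' = (b' :: r').reverse ++ d.reverse := by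
    rw [← List.reverse_append, ← h2, List.reverse_reverse]
  refine ⟨c, (b :: r).reverse, (b' :: r').reverse, d.reverse, ?_, ?_, by simpa using hlen',
    by simp, ?_, by simpa using hb⟩
  · rw [List.append_assoc, ← e1]
  · rw [List.append_assoc, ← e2]
  · have f1 : (a :: t).getD 0 false = (b :: r).reverse.getD 0 false := by
      rw [e1, List.getD_append _ _ _ _ (by simp)]
    have f2 : (a' :: t').getD 0 false = (b' :: r').reverse.getD 0 false := by
      rw [e2, List.getD_append _ _ _ _ (by simp)]
    rw [← f1, ← f2]
    simpa using ha

end Words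

section Collision
variable {α : Type*} [Fintype α] [DecidableEq α]

/-- Upper bound for the collision probability of two words of length at most `m`. -/
noncomputable def collBound (n m : ℕ) : ℝ :=
  1 / ((n : ℝ) - (4 * (m + 1) : ℕ)) ^ 2 +
    ((4 * (m + 1) : ℕ) : ℝ) ^ 6 / ((n : ℝ) - (4 * (m + 1) : ℕ)) ^ 3

lemma collBound_mono {n m m' : ℕ} (h : m ≤ m') (hn : 4 * (m' + 1) < n) :
    collBound n m ≤ collBound n m' := by
  have h1 : ((4 * (m + 1) : ℕ) : ℝ) ≤ (4 * (m' + 1) : ℕ) := by exact_mod_cast (by omega)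
  have h2 : ((4 * (m' + 1) : ℕ) : ℝ) < n := by exact_mod_cast hn
  have h3 : 0 < (n : ℝ) - (4 * (m' + 1) : ℕ) := by linarith
  unfold collBound
  gcongr

/-- Ordered pairs of distinct points. -/
abbrev Pairs (α : Type*) := {q : α × α // q.1 ≠ q.2}

/-- The action of permutations on ordered pairs of distinct points. -/
def pairPerm : Perm α →* Perm (Pairs α) where
  toFun σ :=
    { toFun := fun q => ⟨(σ q.1.1, σ q.1.2), fun h => q.2 (σ.injective h)⟩
      invFun := fun q => ⟨(σ⁻¹ q.1.1, σ⁻¹ q.1.2), fun h => q.2 (σ⁻¹.injective h)⟩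
      left_inv := fun q => by simp
      right_inv := fun q => by simp }
  map_one' := by ext q <;> rfl
  map_mul' σ τ := by ext q <;> rfl

lemma pairPerm_apply_eq_iff (σ τ : Perm α) (q : Pairs α) :
    pairPerm σ q = pairPerm τ q ↔ σ q.1.1 = τ q.1.1 ∧ σ q.1.2 = τ q.1.2 := by
  rw [Subtype.ext_iff, Prod.ext_iff]; rfl

lemma pr_word_collision_le {s s' : List Bool} (hl : s.length = s'.length) (h1 : 1 ≤ s.length)
    (h2 : s.getD 0 false ≠ s'.getD 0 false)
    (h3 : s.reverse.getD 0 false ≠ s'.reverse.getD 0 false)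
    (hn : 4 * (s.length + 1) < Fintype.card α) (q : Pairs α) :
    pr (fun p : Bool → Perm α => pairPerm (ev p s) q = pairPerm (ev p s') q) ≤
      collBound (Fintype.card α) s.length := by
  refine le_trans (pr_mono fun p hp => ?_) (pr_walk_collision_le (ℓ := s.length)
    (u := fun c j => (cond c s' s).reverse.getD j false) (x := fun b => cond b q.1.2 q.1.1)
    q.2 h1 h3 ?_ hn)
  · rw [pairPerm_apply_eq_iff, ev_eq_walk, ev_eq_walk, ev_eq_walk, ev_eq_walk, ← hl] at hp
    intro b
    cases b
    · exact hp.1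
    · exact hp.2
  · have hrev : ∀ l : List Bool, 1 ≤ l.length → l.reverse.getD (l.length - 1) false =
        l.getD 0 false := by
      intro l hl
      cases l with
      | nil => simp at hl
      | cons a t => simp
    dsimp only [cond_true, cond_false]
    rw [hrev s h1, hl, hrev s' (hl ▸ h1)]
    exact h2

lemma expect_collision_le {w w' : List Bool} (hl : w.length = w'.length) (hne : w ≠ w')
    (hn : 4 * (w.length + 1) < Fintype.card α) :
    𝔼 p : Bool → Perm α, (∑ q : Pairs α,
      if pairPerm (ev p w) q = pairPerm (ev p w') q then (1 : ℝ) else 0) ≤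
      Fintype.card (Pairs α) * collBound (Fintype.card α) w.length := by
  obtain ⟨c, s, s', d, rfl, rfl, h1, h2, h3, h4⟩ := exists_strip w w' hl hne
  have hsl : s.length ≤ (c ++ s ++ d).length := by simp; omega
  have key : ∀ p : Bool → Perm α, (∑ q : Pairs α,
      if pairPerm (ev p (c ++ s ++ d)) q = pairPerm (ev p (c ++ s' ++ d)) q
        then (1 : ℝ) else 0) =
      ∑ q : Pairs α, if pairPerm (ev p s) q = pairPerm (ev p s') q then (1 : ℝ) else 0 := by
    intro p
    refine Fintype.sum_equiv (pairPerm (ev p d)) _ _ fun q => ?_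
    simp only [ev_append, map_mul, Perm.mul_apply, EmbeddingLike.apply_eq_iff_eq]
  simp only [key]
  rw [Finset.expect_sum_comm]
  calc _ ≤ ∑ _q : Pairs α, collBound (Fintype.card α) (c ++ s ++ d).length := by
        refine Finset.sum_le_sum fun q _ => ?_
        refine le_trans ?_ (collBound_mono hsl hn)
        rw [← pr_eq_expect]
        exact pr_word_collision_le h1 h2 h3 h4 (by omega) q
    _ = _ := by rw [sum_const, nsmul_eq_mul, card_univ]

/-- Average number of agreements between two independent random elements of a family. -/
noncomputable def avgAgree {X W : Type*} [Fintype X] [Fintype W] (f : W → Perm X) : ℝ :=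
  𝔼 w, 𝔼 w', ∑ x, if f w x = f w' x then (1 : ℝ) else 0

lemma expect_avgAgree_le (m : ℕ) (hn : 4 * (m + 1) < Fintype.card α) :
    𝔼 p : Bool → Perm α, avgAgree (fun w : Fin m → Bool => pairPerm (ev p (List.ofFn w))) ≤
      Fintype.card (Pairs α) * (1 / 2 ^ m + collBound (Fintype.card α) m) := by
  unfold avgAgree
  rw [Finset.expect_comm]
  refine Finset.expect_le univ_nonempty fun w _ => ?_
  rw [Finset.expect_comm]
  have hb : 0 ≤ collBound (Fintype.card α) m := by
    have : ((4 * (m + 1) : ℕ) : ℝ) < Fintype.card α := by exact_mod_cast hn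
    have h3 : 0 < (Fintype.card α : ℝ) - (4 * (m + 1) : ℕ) := by linarith
    unfold collBound
    positivity
  calc _ ≤ 𝔼 w' : Fin m → Bool, ((if w = w' then (Fintype.card (Pairs α) : ℝ) else 0) +
        Fintype.card (Pairs α) * collBound (Fintype.card α) m) := by
        refine Finset.expect_le_expect fun w' _ => ?_
        by_cases h : w = w'
        · subst h
          simp only [if_true, sum_const, card_univ, nsmul_eq_mul, mul_one]
          refine (Finset.expect_const univ_nonempty _).le.trans ?_
          have : 0 ≤ (Fintype.card (Pairs α) : ℝ) * collBound (Fintype.card α) m := by positivity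
          linarith
        · have := expect_collision_le (α := α) (w := List.ofFn w) (w' := List.ofFn w') (by simp)
            (fun h' => h (List.ofFn_injective h')) (by simpa using hn)
          rw [if_neg h, zero_add]
          simp only [List.length_ofFn] at this
          refine le_trans (le_of_eq ?_) this
          congr!
    _ = _ := by
        rw [Finset.expect_add_distrib, Finset.expect_const univ_nonempty, Fintype.expect_ite_eq]
        simp only [Fintype.card_pi, Fintype.card_bool, prod_const, card_univ, Fintype.card_fin]
        rw [NNRat.smul_def]
        push_cast
        ring

end Collision

section Spectral
variable {X W : Type*} [Fintype X] [Fintype W]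

/-- The square of the Frobenius norm. -/
noncomputable def frobSq (A : Matrix X X ℝ) : ℝ := ∑ x, ∑ y, A x y ^ 2

lemma frobSq_nonneg (A : Matrix X X ℝ) : 0 ≤ frobSq A := by
  unfold frobSq; positivity

lemma frobSq_mul_le (A B : Matrix X X ℝ) : frobSq (A * B) ≤ frobSq A * frobSq B := by
  unfold frobSq
  have h : ∀ x y, ((A * B) x y) ^ 2 ≤ (∑ z, A x z ^ 2) * ∑ z, B z y ^ 2 := by
    intro x y
    rw [Matrix.mul_apply]
    exact Finset.sum_mul_sq_le_sq_mul_sq _ _ _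
  calc _ ≤ ∑ x, ∑ y, (∑ z, A x z ^ 2) * ∑ z, B z y ^ 2 :=
        Finset.sum_le_sum fun x _ => Finset.sum_le_sum fun y _ => h x y
    _ = (∑ x, ∑ z, A x z ^ 2) * ∑ y, ∑ z, B z y ^ 2 := by
        rw [Finset.sum_mul]
        exact Finset.sum_congr rfl fun x _ => by rw [Finset.mul_sum]
    _ = _ := by rw [Finset.sum_comm (f := fun y z => B z y ^ 2)]

lemma frobSq_pow_le [DecidableEq X] (A : Matrix X X ℝ) (M : ℕ) :
    frobSq (A ^ (M + 1)) ≤ frobSq A ^ (M + 1) := by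
  induction M with
  | zero => simp
  | succ M ih =>
    rw [pow_succ, pow_succ (frobSq A)]
    exact (frobSq_mul_le _ _).trans (mul_le_mul_of_nonneg_right ih (frobSq_nonneg _))

lemma abs_le_of_frobSq_le {A : Matrix X X ℝ} {c : ℝ} (hc : 0 ≤ c) (h : frobSq A ≤ c ^ 2)
    (x y : X) : |A x y| ≤ c := by
  refine abs_le_of_sq_le_sq (le_trans ?_ h) hc
  unfold frobSq
  calc A x y ^ 2 ≤ ∑ y, A x y ^ 2 :=
        Finset.single_le_sum (f := fun y => A x y ^ 2) (fun _ _ => by positivity) (mem_univ y)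
    _ ≤ _ := Finset.single_le_sum (f := fun x => ∑ y, A x y ^ 2) (fun _ _ => by positivity)
        (mem_univ x)

variable (f : W → Perm X)

/-- Transition matrix of the random walk driven by a family of permutations. -/
noncomputable def transMat : Matrix X X ℝ := fun x y => 𝔼 w, if f w x = y then 1 else 0

lemma sum_transMat_right [Nonempty W] (x : X) : ∑ y, transMat f x y = 1 := by
  unfold transMat
  rw [← Finset.expect_sum_comm]
  simp

lemma sum_transMat_left [Nonempty W] (y : X) : ∑ x, transMat f x y = 1 := by
  unfold transMat
  rw [← Finset.expect_sum_comm]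
  refine (Finset.expect_congr rfl fun w _ => ?_).trans (Fintype.expect_one)
  rw [Finset.sum_congr rfl fun x _ => by rw [← Equiv.eq_symm_apply]]
  simp

lemma frobSq_transMat : frobSq (transMat f) = avgAgree f := by
  unfold frobSq transMat avgAgree
  have : ∀ x y, (𝔼 w, if f w x = y then (1 : ℝ) else 0) ^ 2 =
      𝔼 w, 𝔼 w', if f w x = y ∧ f w' x = y then (1 : ℝ) else 0 := by
    intro x y
    rw [pow_two, Finset.expect_mul_expect]
    refine Finset.expect_congr rfl fun w _ => Finset.expect_congr rfl fun w' _ => ?_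
    by_cases h : f w x = y <;> by_cases h' : f w' x = y <;> simp [h, h']
  simp only [this]
  simp only [← Finset.expect_sum_comm]
  refine Finset.expect_congr rfl fun w _ => Finset.expect_congr rfl fun w' _ => ?_
  refine Finset.sum_congr rfl fun x _ => ?_
  by_cases h : f w x = f w' x
  · rw [if_pos h, Finset.sum_eq_single (f w x)]
    · simp [h]
    · intro y _ hy
      rw [if_neg fun h' => hy h'.1.symm]
    · simp
  · rw [if_neg h]
    refine Finset.sum_eq_zero fun y _ => if_neg fun h' => h (h'.1.trans h'.2.symm)

/-- The uniform transition matrix. -/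
noncomputable def unifMat (X : Type*) [Fintype X] : Matrix X X ℝ :=
  fun _ _ => 1 / (Fintype.card X : ℝ)

lemma frobSq_sub_unifMat [Nonempty X] [Nonempty W] :
    frobSq (transMat f - unifMat X) = avgAgree f - 1 := by
  rw [← frobSq_transMat]
  have hX : (Fintype.card X : ℝ) ≠ 0 := by exact_mod_cast Fintype.card_ne_zero
  have : ∀ x, ∑ y, (transMat f - unifMat X) x y ^ 2 =
      ∑ y, transMat f x y ^ 2 - 1 / (Fintype.card X : ℝ) := by
    intro x
    have h : ∀ y, (transMat f - unifMat X) x y ^ 2 = transMat f x y ^ 2 -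
        2 * (1 / (Fintype.card X : ℝ)) * transMat f x y + (1 / (Fintype.card X : ℝ)) ^ 2 := by
      intro y
      rw [Matrix.sub_apply, unifMat]
      ring
    simp only [h]
    rw [Finset.sum_add_distrib, Finset.sum_sub_distrib, ← Finset.mul_sum, sum_transMat_right,
      sum_const, card_univ, nsmul_eq_mul]
    field_simp
    ring
  unfold frobSq
  simp only [this]
  rw [Finset.sum_sub_distrib, sum_const, card_univ, nsmul_eq_mul]
  field_simp

lemma sub_unifMat_pow [Nonempty X] [Nonempty W] [DecidableEq X] (M : ℕ) :
    (transMat f - unifMat X) ^ (M + 1) = transMat f ^ (M + 1) - unifMat X := by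
  have hX : (Fintype.card X : ℝ) ≠ 0 := by exact_mod_cast Fintype.card_ne_zero
  have h1 : unifMat X * transMat f = unifMat X := by
    ext x y
    rw [Matrix.mul_apply]
    simp only [unifMat]
    rw [← Finset.mul_sum, sum_transMat_left, mul_one]
  have h2 : transMat f * unifMat X = unifMat X := by
    ext x y
    rw [Matrix.mul_apply]
    simp only [unifMat]
    rw [← Finset.sum_mul, sum_transMat_right, one_mul]
  have h3 : unifMat X * unifMat X = unifMat X := by
    ext x y
    rw [Matrix.mul_apply]
    simp only [unifMat]
    rw [sum_const, card_univ, nsmul_eq_mul]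
    field_simp
  have h4 : ∀ k, transMat f ^ k * unifMat X = unifMat X := by
    intro k
    induction k with
    | zero => simp
    | succ k ih => rw [pow_succ, mul_assoc, h2, ih]
  induction M with
  | zero => simp
  | succ M ih =>
    rw [pow_succ, ih, sub_mul, mul_sub, mul_sub, h1, h3, h4, ← pow_succ]
    abel

lemma transMat_pow_apply [DecidableEq X] [Nonempty W] (M : ℕ) (x y : X) :
    (transMat f ^ M) x y =
      𝔼 v : Fin M → W, if (List.ofFn fun i => f (v i)).prod x = y then (1 : ℝ) else 0 := by
  induction M generalizing x y with
  | zero =>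
    simp [Matrix.one_apply]
  | succ M ih =>
    rw [pow_succ, Matrix.mul_apply]
    simp only [ih, transMat]
    rw [← Fintype.expect_equiv (Fin.consEquiv fun _ : Fin (M + 1) => W)
      (fun q => if (List.ofFn fun i => f (Fin.cons (α := fun _ => W) q.1 q.2 i)).prod x = y
        then (1 : ℝ) else 0) _ (fun q => rfl)]
    rw [← Finset.univ_product_univ, Finset.expect_product, Finset.expect_comm]
    simp only [Finset.expect_mul_expect]
    rw [← Finset.expect_sum_comm]
    refine Finset.expect_congr rfl fun v _ => ?_
    rw [← Finset.expect_sum_comm]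
    refine Finset.expect_congr rfl fun w _ => ?_
    simp only [List.ofFn_succ, Fin.cons_zero, Fin.cons_succ, List.prod_cons, Perm.mul_apply]
    rw [Finset.sum_eq_single ((List.ofFn fun i => f (v i)).prod x)]
    · simp
    · intro z _ hz
      rw [if_neg (Ne.symm hz), zero_mul]
    · simp

/-- Rapid mixing of the walk when two random members of the family rarely agree. -/
lemma abs_pr_prod_sub_le [Nonempty X] [Nonempty W] [DecidableEq X]
    (h : avgAgree f ≤ 1 + 1 / 16) (M : ℕ) (x y : X) :
    |pr (fun v : Fin (M + 1) → W => (List.ofFn fun i => f (v i)).prod x = y) -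
      1 / (Fintype.card X : ℝ)| ≤ (1 / 4) ^ (M + 1) := by
  have h1 : frobSq (transMat f - unifMat X) ≤ (1 / 4) ^ 2 := by
    rw [frobSq_sub_unifMat]; linarith
  have h2 := (frobSq_pow_le (transMat f - unifMat X) M).trans
    (pow_le_pow_left₀ (frobSq_nonneg _) h1 (M + 1))
  rw [← pow_mul, mul_comm, pow_mul, sub_unifMat_pow] at h2
  have h3 := abs_le_of_frobSq_le (by positivity) h2 x y
  rw [Matrix.sub_apply, transMat_pow_apply] at h3
  rwa [pr_eq_expect]

end Spectral

section TwoMix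
variable {α : Type*} [Fintype α] [DecidableEq α]

/-- Words of length at most `L` act on pairs of points in a nearly uniform way. -/
def TwoMix (p : Bool → Perm α) (L : ℕ) : Prop :=
  ∃ (W : Type) (_ : Fintype W) (_ : Nonempty W) (e : W → Perm α), (∀ w, WL p L (e w)) ∧
    ∀ x₁ x₂ y₁ y₂ : α, x₁ ≠ x₂ → y₁ ≠ y₂ →
      |pr (fun w => e w x₁ = y₁ ∧ e w x₂ = y₂) -
        1 / ((Fintype.card α : ℝ) * (Fintype.card α - 1))| ≤
        1 / 10 * (1 / ((Fintype.card α : ℝ) * (Fintype.card α - 1)))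

lemma card_pairs : (Fintype.card (Pairs α) : ℝ) = (Fintype.card α : ℝ) * (Fintype.card α - 1) := by
  have h : Fintype.card (Pairs α) = Fintype.card α * Fintype.card α - Fintype.card α := by
    rw [← Finset.card_univ (α := α), ← Finset.offDiag_card, Fintype.card_subtype]
    congr 1
    ext q
    simp
  rw [h, Nat.cast_sub (Nat.le_mul_self _)]
  push_cast; ring

lemma twoMix_of_avgAgree {p : Bool → Perm α} {m M : ℕ}
    (h : avgAgree (fun w : Fin m → Bool => pairPerm (ev p (List.ofFn w))) ≤ 1 + 1 / 16)
    (hM : (1 / 4 : ℝ) ^ (M + 1) ≤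
      1 / 10 * (1 / ((Fintype.card α : ℝ) * (Fintype.card α - 1)))) :
    TwoMix p (m * (M + 1)) := by
  refine ⟨Fin (M + 1) → Fin m → Bool, inferInstance, inferInstance,
    fun v => (List.ofFn fun i => ev p (List.ofFn (v i))).prod, fun v => ?_, ?_⟩
  · have := WL.list_prod (p := p) (ℓ := m)
      (l := List.ofFn fun i => ev p (List.ofFn (v i))) (by
        intro σ hσ
        rw [List.mem_ofFn] at hσ
        obtain ⟨i, rfl⟩ := hσ
        simpa using WL.ev (p := p) (List.ofFn (v i)))
    simpa using this
  · intro x₁ x₂ y₁ y₂ hx hy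
    have : Nonempty (Pairs α) := ⟨⟨(x₁, x₂), hx⟩⟩
    have key := abs_pr_prod_sub_le _ h M ⟨(x₁, x₂), hx⟩ ⟨(y₁, y₂), hy⟩
    rw [card_pairs] at key
    refine le_trans (le_of_eq ?_) (key.trans hM)
    congr 2
    refine pr_congr fun v => ?_
    have e : (List.ofFn fun i => pairPerm (ev p (List.ofFn (v i)))).prod =
        pairPerm (List.ofFn fun i => ev p (List.ofFn (v i))).prod := by
      rw [map_list_prod, List.map_ofFn]; rfl
    rw [e, Subtype.ext_iff, Prod.ext_iff]
    rfl

lemma pr_not_twoMix_le {m M : ℕ} (hn : 4 * (m + 1) < Fintype.card α)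
    (hM : (1 / 4 : ℝ) ^ (M + 1) ≤
      1 / 10 * (1 / ((Fintype.card α : ℝ) * (Fintype.card α - 1)))) :
    pr (fun p : Bool → Perm α => ¬ TwoMix p (m * (M + 1))) ≤
      16 * ((Fintype.card α : ℝ) * (Fintype.card α - 1) *
        (1 / 2 ^ m + collBound (Fintype.card α) m) - 1) := by
  set f : (Bool → Perm α) → ℝ := fun p =>
    avgAgree (fun w : Fin m → Bool => pairPerm (ev p (List.ofFn w))) - 1
  have : Nonempty (Pairs α) := by
    have : 1 < Fintype.card α := by omega
    obtain ⟨a, b, hab⟩ := Fintype.exists_pair_of_one_lt_card this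
    exact ⟨⟨(a, b), hab⟩⟩
  have hf : ∀ p, 0 ≤ f p := by
    intro p
    have := frobSq_sub_unifMat (fun w : Fin m → Bool => pairPerm (ev p (List.ofFn w)))
    simp only [f]
    rw [← this]
    exact frobSq_nonneg _
  have h1 := pr_markov f hf (1 / 16)
  have h2 : 𝔼 p, f p ≤ (Fintype.card α : ℝ) * (Fintype.card α - 1) *
        (1 / 2 ^ m + collBound (Fintype.card α) m) - 1 := by
    simp only [f]
    rw [Finset.expect_sub_distrib, Finset.expect_const univ_nonempty, ← card_pairs]
    have := expect_avgAgree_le (α := α) m hn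
    linarith
  have h3 : pr (fun p : Bool → Perm α => ¬ TwoMix p (m * (M + 1))) ≤
      pr (fun p => 1 / 16 ≤ f p) := by
    refine pr_mono fun p hp => ?_
    by_contra hlt
    refine hp (twoMix_of_avgAgree ?_ hM)
    simp only [f] at hlt
    linarith
  linarith

end TwoMix

section Asymptotics
open Filter Topology

lemma clog_le_log {n : ℕ} (hn : 3 ≤ n) : (Nat.clog 2 n : ℝ) ≤ 3 * Real.log n := by
  have hn0 : (0 : ℝ) < n := by positivity
  have h1 : (1 : ℝ) ≤ Real.log n := by
    rw [Real.le_log_iff_exp_le hn0]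
    have : (3 : ℝ) ≤ n := by exact_mod_cast hn
    linarith [Real.exp_one_lt_d9]
  have h2 : 2 ^ (Nat.clog 2 n - 1) < n := Nat.pow_pred_clog_lt_self (by norm_num) (by omega)
  have h3 : 1 ≤ Nat.clog 2 n := Nat.clog_pos (by norm_num) (by omega)
  have h4 : ((2 : ℝ) ^ (Nat.clog 2 n - 1)) ≤ n := by exact_mod_cast h2.le
  have h5 := Real.log_le_log (by positivity) h4
  rw [Real.log_pow, Nat.cast_sub h3] at h5
  have h6 := Real.log_two_gt_d9
  push_cast at h5
  have h7 : (0 : ℝ) ≤ (Nat.clog 2 n : ℝ) - 1 := by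
    have : (1 : ℝ) ≤ (Nat.clog 2 n : ℝ) := by exact_mod_cast h3
    linarith
  nlinarith

lemma tendsto_clog_pow_div (k : ℕ) :
    Tendsto (fun n : ℕ => (Nat.clog 2 n : ℝ) ^ k / n) atTop (𝓝 0) := by
  have h1 : Tendsto (fun n : ℕ => 3 ^ k * (Real.log n ^ k / n)) atTop (𝓝 0) := by
    have := (Real.isLittleO_pow_log_id_atTop (n := k)).tendsto_div_nhds_zero
    have := (this.comp tendsto_natCast_atTop_atTop).const_mul ((3 : ℝ) ^ k)
    simpa using this
  refine squeeze_zero' (Eventually.of_forall fun n => by positivity) ?_ h1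
  filter_upwards [eventually_ge_atTop 3] with n hn
  rw [← mul_div_assoc, ← mul_pow]
  gcongr
  exact clog_le_log hn

/-- The length of the mixing words. -/
def mixLen (n : ℕ) : ℕ := 3 * Nat.clog 2 n * (Nat.clog 2 n + 2)

lemma eventually_twoMix (ε : ℝ) (hε : 0 < ε) :
    ∀ᶠ n : ℕ in atTop, pr (fun p : Bool → Perm (Fin n) => ¬ TwoMix p (mixLen n)) ≤ ε := by
  set T : ℕ → ℕ := fun n => 4 * (3 * Nat.clog 2 n + 1) with hT
  have hTle : ∀ᶠ n : ℕ in atTop, (T n : ℝ) ≤ 16 * Nat.clog 2 n := by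
    filter_upwards [eventually_ge_atTop 2] with n hn
    have h3 : 1 ≤ Nat.clog 2 n := Nat.clog_pos (by norm_num) (by omega)
    have : T n ≤ 16 * Nat.clog 2 n := by simp only [hT]; omega
    exact_mod_cast this
  have hr : Tendsto (fun n => (T n : ℝ) / n) atTop (𝓝 0) := by
    have h1 := (tendsto_clog_pow_div 1).const_mul 16
    rw [mul_zero] at h1
    refine squeeze_zero' (Eventually.of_forall fun n => by positivity) ?_ h1
    filter_upwards [hTle] with n hn
    rw [pow_one, ← mul_div_assoc]
    gcongr
  have hs : Tendsto (fun n => (T n : ℝ) ^ 6 / n) atTop (𝓝 0) := by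
    have h1 := (tendsto_clog_pow_div 6).const_mul (16 ^ 6)
    rw [mul_zero] at h1
    refine squeeze_zero' (Eventually.of_forall fun n => by positivity) ?_ h1
    filter_upwards [hTle] with n hn
    rw [← mul_div_assoc, ← mul_pow]
    gcongr
  have hinv : Tendsto (fun n : ℕ => (1 : ℝ) / n) atTop (𝓝 0) := tendsto_one_div_atTop_nhds_zero_nat
  have hlim : Tendsto (fun n : ℕ => 16 * ((1 : ℝ) / n + 1 / (1 - (T n : ℝ) / n) ^ 2 +
      ((T n : ℝ) ^ 6 / n) / (1 - (T n : ℝ) / n) ^ 3 - 1)) atTop (𝓝 0) := by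
    have h1 : Tendsto (fun n => 1 - (T n : ℝ) / n) atTop (𝓝 1) := by
      simpa using hr.const_sub 1
    have h2 := (h1.pow 2)
    have h3 := (h1.pow 3)
    have h4 := (((hinv.add ((tendsto_const_nhds (x := (1 : ℝ))).div h2 (by norm_num))).add
      (hs.div h3 (by norm_num))).sub_const 1).const_mul 16
    simpa using h4
  filter_upwards [hlim.eventually (eventually_le_nhds hε), eventually_ge_atTop 2,
    hr.eventually (eventually_lt_nhds (show (0 : ℝ) < 1 by norm_num))] with n h1 h2 h3
  have hn0 : (0 : ℝ) < n := by positivity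
  have hTn : T n < n := by
    rw [div_lt_one hn0] at h3
    exact_mod_cast h3
  have hpow : n ≤ 2 ^ Nat.clog 2 n := Nat.le_pow_clog (by norm_num) n
  have hpowR : (n : ℝ) ≤ 2 ^ Nat.clog 2 n := by exact_mod_cast hpow
  have hn1 : (1 : ℝ) ≤ (n : ℝ) - 1 := by
    have : (2 : ℝ) ≤ n := by exact_mod_cast h2
    linarith
  have key := pr_not_twoMix_le (α := Fin n) (m := 3 * Nat.clog 2 n) (M := Nat.clog 2 n + 1)
    (by rw [Fintype.card_fin]; exact hTn) (by
      rw [Fintype.card_fin, one_div_pow, one_div_mul_one_div]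
      refine one_div_le_one_div_of_le (by positivity) ?_
      have : (4 : ℝ) ^ (Nat.clog 2 n + 1 + 1) = 16 * (2 ^ Nat.clog 2 n * 2 ^ Nat.clog 2 n) := by
        rw [pow_succ, pow_succ, ← mul_pow]; norm_num; ring
      rw [this]
      nlinarith)
  rw [Fintype.card_fin] at key
  refine key.trans (le_trans ?_ h1)
  have hTeq : (4 * (3 * Nat.clog 2 n + 1)) = T n := rfl
  unfold collBound
  rw [hTeq]
  have hnT : (0 : ℝ) < n - T n := by
    have : (T n : ℝ) < n := by exact_mod_cast hTn
    linarith
  have hp3 : (n : ℝ) ^ 3 ≤ 2 ^ (3 * Nat.clog 2 n) := by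
    rw [mul_comm 3, pow_mul]
    gcongr
  have e1 : 1 - (T n : ℝ) / n = (n - T n) / n := by field_simp
  rw [e1]
  have h5 : (n : ℝ) * (n - 1) * (1 / 2 ^ (3 * Nat.clog 2 n) +
      (1 / ((n : ℝ) - T n) ^ 2 + (T n : ℝ) ^ 6 / ((n : ℝ) - T n) ^ 3)) ≤
      (n : ℝ) * n * (1 / n ^ 3 +
      (1 / ((n : ℝ) - T n) ^ 2 + (T n : ℝ) ^ 6 / ((n : ℝ) - T n) ^ 3)) := by
    gcongr
    linarith
  have h6 : (n : ℝ) * n * (1 / n ^ 3 +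
      (1 / ((n : ℝ) - T n) ^ 2 + (T n : ℝ) ^ 6 / ((n : ℝ) - T n) ^ 3)) =
      1 / n + 1 / (((n : ℝ) - T n) / n) ^ 2 + ((T n : ℝ) ^ 6 / n) / (((n : ℝ) - T n) / n) ^ 3 := by
    field_simp
    ring
  rw [← h6]
  linarith

end Asymptotics

section Commutators
variable {α : Type*} [Fintype α] [DecidableEq α]

lemma pr_eq_sum_fiber {Ω β : Type*} [Fintype Ω] [Fintype β] (A : Ω → Prop) (g : Ω → β) :
    pr A = ∑ b, pr (fun ω => A ω ∧ g ω = b) := by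
  unfold pr
  rw [← Finset.expect_sum_comm]
  refine Finset.expect_congr rfl fun ω _ => ?_
  by_cases h : A ω <;> simp [h]

lemma perm_apply_inv (σ : Perm α) (x : α) : σ (σ⁻¹ x) = x := by simp

lemma support_commutator_subset (τ σ : Perm α) :
    (τ * σ * τ⁻¹ * σ⁻¹).support ⊆ (τ.support ∩ σ.support) ∪ (τ.support ∩ σ.support).image τ ∪
      (τ.support ∩ σ.support).image σ := by
  intro x hx
  by_contra hnot
  simp only [mem_union, mem_image, mem_inter, not_or, not_exists, not_and, and_imp,
    Perm.mem_support] at hnot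
  obtain ⟨⟨h1, h2⟩, h3⟩ := hnot
  rw [Perm.mem_support] at hx
  apply hx
  simp only [Perm.mul_apply]
  by_cases hσ : σ x = x
  · have e1 : σ⁻¹ x = x := by rw [Perm.inv_eq_iff_eq, hσ]
    rw [e1]
    by_cases hτ : τ x = x
    · have e2 : τ⁻¹ x = x := by rw [Perm.inv_eq_iff_eq, hτ]
      rw [e2, hσ, hτ]
    · have e3 : σ (τ⁻¹ x) = τ⁻¹ x := by
        by_contra h
        refine h2 (τ⁻¹ x) ?_ h (by simp)
        intro h'
        rw [perm_apply_inv] at h'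
        exact hτ (Perm.inv_eq_iff_eq.1 h'.symm).symm
      rw [e3, perm_apply_inv]
  · have hτ : τ x = x := by
      by_contra h
      exact hσ (by_contra fun h' => (h1 h) h')
    have e3 : τ (σ⁻¹ x) = σ⁻¹ x := by
      by_contra h
      refine h3 (σ⁻¹ x) h ?_ (by simp)
      intro h'
      rw [perm_apply_inv] at h'
      apply hσ
      exact (Perm.inv_eq_iff_eq.1 h'.symm).symm
    have e4 : τ⁻¹ (σ⁻¹ x) = σ⁻¹ x := by rw [Perm.inv_eq_iff_eq, e3]
    rw [e4, perm_apply_inv, hτ]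

lemma card_support_commutator_le (τ σ : Perm α) :
    (τ * σ * τ⁻¹ * σ⁻¹).support.card ≤ 3 * (τ.support ∩ σ.support).card := by
  refine (card_le_card (support_commutator_subset τ σ)).trans ?_
  refine (card_union_le _ _).trans ?_
  have h1 := card_union_le (τ.support ∩ σ.support) ((τ.support ∩ σ.support).image τ)
  have h2 : ((τ.support ∩ σ.support).image τ).card ≤ _ := card_image_le
  have h3 : ((τ.support ∩ σ.support).image σ).card ≤ _ := card_image_le
  omega

lemma isThreeCycle_commutator {τ σ : Perm α} (hne : τ * σ * τ⁻¹ * σ⁻¹ ≠ 1)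
    (h : (τ.support ∩ σ.support).card ≤ 1) : (τ * σ * τ⁻¹ * σ⁻¹).IsThreeCycle := by
  rw [← card_support_eq_three_iff]
  have h1 := card_support_commutator_le τ σ
  have h2 := Perm.one_lt_card_support_of_ne_one hne
  have h3 : (τ * σ * τ⁻¹ * σ⁻¹).support.card ≠ 2 := by
    intro h3
    have := (Perm.card_support_eq_two.1 h3).sign_eq
    simp only [map_mul, map_inv] at this
    rw [mul_comm (Perm.sign τ), mul_assoc (Perm.sign σ), mul_inv_cancel, mul_one,
      mul_inv_cancel] at this
    exact absurd this (by decide)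
  omega

lemma exists_good_conjugator {p : Bool → Perm α} {L : ℕ} (hp : TwoMix p L) {τ : Perm α}
    (hτ : τ ≠ 1) (ha : 24 * τ.support.card ≤ Fintype.card α) {lam : ℝ} (hlam : 1 ≤ lam)
    (hlam' : 2 * (τ.support.card : ℝ) ^ 2 / Fintype.card α ≤ lam) :
    ∃ σ, WL p L σ ∧ ∃ x, τ x ≠ x ∧ τ x ∈ τ.support.image σ ∧ x ∉ τ.support.image σ ∧
      (((τ.support ∩ τ.support.image σ).erase (τ x)).card : ℝ) < lam := by
  obtain ⟨W, _, _, e, he, hmix⟩ := hp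
  set A := τ.support
  set n := Fintype.card α
  have hA2 : 1 < A.card := Perm.one_lt_card_support_of_ne_one hτ
  obtain ⟨y₀, hy₀, y₁, hy₁, hy⟩ := Finset.one_lt_card.1 hA2
  set x := y₀
  have hx : τ x ≠ x := Perm.mem_support.1 hy₀
  have hnR : (24 : ℝ) * A.card ≤ n := by exact_mod_cast ha
  have ha2R : (2 : ℝ) ≤ A.card := by exact_mod_cast hA2
  set N : ℝ := (n : ℝ) * (n - 1) with hN
  have hN0 : 0 < N := mul_pos (by linarith) (by linarith)
  have hup : ∀ x₁ x₂ z₁ z₂ : α, x₁ ≠ x₂ → z₁ ≠ z₂ →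
      pr (fun w => e w x₁ = z₁ ∧ e w x₂ = z₂) ≤ 11 / 10 * (1 / N) := by
    intro x₁ x₂ z₁ z₂ h1 h2
    have := (abs_le.1 (hmix x₁ x₂ z₁ z₂ h1 h2)).2
    linarith
  have hlo : ∀ x₁ x₂ z₁ z₂ : α, x₁ ≠ x₂ → z₁ ≠ z₂ →
      9 / 10 * (1 / N) ≤ pr (fun w => e w x₁ = z₁ ∧ e w x₂ = z₂) := by
    intro x₁ x₂ z₁ z₂ h1 h2
    have := (abs_le.1 (hmix x₁ x₂ z₁ z₂ h1 h2)).1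
    linarith
  have hF : 9 / 10 * (1 / N) * (n - 1) ≤ pr (fun w => e w y₀ = τ x) := by
    rw [pr_eq_sum_fiber (fun w => e w y₀ = τ x) (fun w => e w y₁)]
    calc 9 / 10 * (1 / N) * ((n : ℝ) - 1) = ∑ _z ∈ univ.erase (τ x), 9 / 10 * (1 / N) := by
          rw [sum_const, nsmul_eq_mul, card_erase_of_mem (mem_univ _), card_univ,
            Nat.cast_sub (by omega)]
          push_cast; ring
      _ ≤ ∑ z ∈ univ.erase (τ x), pr (fun w => e w y₀ = τ x ∧ e w y₁ = z) :=
          Finset.sum_le_sum fun z hz => hlo _ _ _ _ hy (ne_of_mem_erase hz).symm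
      _ ≤ _ := Finset.sum_le_sum_of_subset_of_nonneg (subset_univ _)
          fun _ _ _ => pr_nonneg _
  by_contra hcon
  push Not at hcon
  have hall : ∀ w, e w y₀ = τ x → x ∉ A.image (e w) →
      lam ≤ (((A ∩ A.image (e w)).erase (τ x)).card : ℝ) := by
    intro w hw hxw
    exact hcon (e w) (he w) x hx (mem_image.2 ⟨y₀, hy₀, hw⟩) hxw
  have hb1 : pr (fun w => e w y₀ = τ x ∧ x ∈ A.image (e w)) ≤
      (A.card - 1) * (11 / 10 * (1 / N)) := by
    calc _ ≤ pr (fun w => ∃ y ∈ A.erase y₀, e w y₀ = τ x ∧ e w y = x) := by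
          refine pr_mono ?_
          rintro w ⟨h1, h2⟩
          obtain ⟨y, hyA, hyx⟩ := mem_image.1 h2
          refine ⟨y, mem_erase.2 ⟨?_, hyA⟩, h1, hyx⟩
          rintro rfl
          exact hx (h1.symm.trans hyx)
      _ ≤ ∑ y ∈ A.erase y₀, pr (fun w => e w y₀ = τ x ∧ e w y = x) := pr_exists_mem_le _ _
      _ ≤ ∑ _y ∈ A.erase y₀, 11 / 10 * (1 / N) :=
          Finset.sum_le_sum fun y hy' => hup _ _ _ _ (ne_of_mem_erase hy').symm hx
      _ = _ := by
          rw [sum_const, nsmul_eq_mul, card_erase_of_mem hy₀, Nat.cast_sub (by omega)]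
          push_cast; ring
  have hb2 : pr (fun w => e w y₀ = τ x ∧ lam ≤ (((A ∩ A.image (e w)).erase (τ x)).card : ℝ)) *
      lam ≤ (A.card - 1) ^ 2 * (11 / 10 * (1 / N)) := by
    set f : W → ℝ := fun w => if e w y₀ = τ x then
      (((A ∩ A.image (e w)).erase (τ x)).card : ℝ) else 0
    have hf : ∀ w, 0 ≤ f w := by
      intro w; simp only [f]; split_ifs <;> positivity
    calc _ ≤ pr (fun w => lam ≤ f w) * lam := by
          refine mul_le_mul_of_nonneg_right (pr_mono ?_) (by linarith)
          rintro w ⟨h1, h2⟩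
          simp only [f]
          rwa [if_pos h1]
      _ ≤ 𝔼 w, f w := pr_markov f hf lam
      _ ≤ 𝔼 w, ∑ y ∈ A.erase y₀, ∑ z ∈ A.erase (τ x),
          (if e w y₀ = τ x ∧ e w y = z then (1 : ℝ) else 0) := by
          refine Finset.expect_le_expect fun w _ => ?_
          simp only [f]
          split_ifs with h
          · simp only [h, true_and]
            rw [Finset.sum_comm]
            have : ((A ∩ A.image (e w)).erase (τ x)).card ≤
                ∑ z ∈ A.erase (τ x), if z ∈ A.image (e w) then 1 else 0 := by
              rw [Finset.sum_boole, Nat.cast_id]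
              refine card_le_card fun z hz => ?_
              rw [mem_erase, mem_inter] at hz
              exact mem_filter.2 ⟨mem_erase.2 ⟨hz.1, hz.2.1⟩, hz.2.2⟩
            have hcast : (((A ∩ A.image (e w)).erase (τ x)).card : ℝ) ≤
                ∑ z ∈ A.erase (τ x), if z ∈ A.image (e w) then (1 : ℝ) else 0 := by
              exact_mod_cast this
            refine hcast.trans ?_
            refine Finset.sum_le_sum fun z hz => ?_
            split_ifs with hz'
            · obtain ⟨y, hyA, hyz⟩ := mem_image.1 hz'
              have hyy : y ∈ A.erase y₀ := by
                refine mem_erase.2 ⟨?_, hyA⟩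
                rintro rfl
                exact ne_of_mem_erase hz (hyz.symm.trans h)
              refine le_trans (by rw [if_pos hyz]) (Finset.single_le_sum
                (f := fun y => if e w y = z then (1 : ℝ) else 0)
                (fun _ _ => by positivity) hyy)
            · positivity
          · positivity
      _ = ∑ y ∈ A.erase y₀, ∑ z ∈ A.erase (τ x), pr (fun w => e w y₀ = τ x ∧ e w y = z) := by
          rw [Finset.expect_sum_comm]
          refine Finset.sum_congr rfl fun y _ => ?_
          rw [Finset.expect_sum_comm]
          refine Finset.sum_congr rfl fun z _ => ?_
          rw [pr_eq_expect]
      _ ≤ ∑ _y ∈ A.erase y₀, ∑ _z ∈ A.erase (τ x), 11 / 10 * (1 / N) :=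
          Finset.sum_le_sum fun y hy' => Finset.sum_le_sum fun z hz =>
            hup _ _ _ _ (ne_of_mem_erase hy').symm (ne_of_mem_erase hz).symm
      _ = _ := by
          have hτxA : τ x ∈ A := Perm.apply_mem_support.2 hy₀
          rw [sum_const, sum_const, nsmul_eq_mul, nsmul_eq_mul, card_erase_of_mem hy₀,
            card_erase_of_mem hτxA, Nat.cast_sub (by omega)]
          push_cast; ring
  have hsplit : pr (fun w => e w y₀ = τ x) ≤
      pr (fun w => e w y₀ = τ x ∧ x ∈ A.image (e w)) +
      pr (fun w => e w y₀ = τ x ∧ lam ≤ (((A ∩ A.image (e w)).erase (τ x)).card : ℝ)) := by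
    refine (pr_mono fun w hw => ?_).trans (pr_or_le _ _)
    by_cases h : x ∈ A.image (e w)
    · exact Or.inl ⟨hw, h⟩
    · exact Or.inr ⟨hw, hall w hw h⟩
  set P2 := pr (fun w => e w y₀ = τ x ∧ lam ≤ (((A ∩ A.image (e w)).erase (τ x)).card : ℝ))
  set a : ℝ := (A.card : ℝ)
  have hP2 : P2 ≤ (a - 1) ^ 2 / lam * (11 / 10 * (1 / N)) := by
    rw [div_mul_eq_mul_div, le_div_iff₀ (by linarith)]
    exact hb2
  have hfrac : (a - 1) ^ 2 / lam ≤ n / 2 := by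
    rw [div_le_iff₀ (by linarith)]
    rw [div_le_iff₀ (by linarith)] at hlam'
    nlinarith
  have hmain : 9 / 10 * (1 / N) * ((n : ℝ) - 1) ≤
      (11 / 10 * (1 / N)) * ((a - 1) + n / 2) := by
    have : (a - 1) ^ 2 / lam * (11 / 10 * (1 / N)) ≤ n / 2 * (11 / 10 * (1 / N)) := by
      gcongr
    linarith
  have hNinv : 0 < 1 / N := by positivity
  have : (1 / N) * (9 / 10 * ((n : ℝ) - 1) - 11 / 10 * ((a - 1) + n / 2)) ≤ 0 := by
    linarith
  have h9 : 0 < 9 / 10 * ((n : ℝ) - 1) - 11 / 10 * ((a - 1) + n / 2) := by linarith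
  linarith [mul_pos hNinv h9]

lemma support_conj_eq_image (σ τ : Perm α) :
    (σ * τ * σ⁻¹).support = τ.support.image σ := by
  rw [Perm.support_conj, Finset.map_eq_image]; rfl

/-- One commutation step: the support shrinks quadratically, or one reaches a 3-cycle. -/
lemma exists_commutator_step {p : Bool → Perm α} {L ℓ : ℕ} (hp : TwoMix p L) {τ : Perm α}
    (hτ : τ ≠ 1) (hw : WL p ℓ τ) (ha : 24 * τ.support.card ≤ Fintype.card α) :
    ∃ τ', WL p (4 * ℓ + 4 * L) τ' ∧ τ' ≠ 1 ∧ (τ'.IsThreeCycle ∨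
      (τ'.support.card : ℝ) ≤ 12 * (τ.support.card : ℝ) ^ 2 / Fintype.card α) := by
  set lam := max 1 (2 * (τ.support.card : ℝ) ^ 2 / Fintype.card α) with hlam
  obtain ⟨σ, hσ, x, hx, hxB, hxnB, hcard⟩ := exists_good_conjugator hp hτ ha
    (lam := lam) (le_max_left _ _) (le_max_right _ _)
  set ρ := σ * τ * σ⁻¹ with hρ
  have hB : ρ.support = τ.support.image σ := support_conj_eq_image σ τ
  rw [← hB] at hxB hxnB hcard
  have hne : τ * ρ * τ⁻¹ * ρ⁻¹ ≠ 1 := by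
    intro h
    have h1 : τ * ρ = ρ * τ := by
      rw [mul_inv_eq_one, mul_inv_eq_iff_eq_mul] at h
      exact h
    have h2 := congrArg (fun f : Perm α => f x) h1
    simp only [Perm.mul_apply] at h2
    rw [Perm.notMem_support.1 hxnB] at h2
    exact Perm.mem_support.1 hxB h2.symm
  have hmem : τ x ∈ τ.support ∩ ρ.support :=
    mem_inter.2 ⟨Perm.apply_mem_support.2 (Perm.mem_support.2 hx), hxB⟩
  have hinter : (τ.support ∩ ρ.support).card = ((τ.support ∩ ρ.support).erase (τ x)).card + 1 := by
    rw [card_erase_add_one hmem]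
  refine ⟨τ * ρ * τ⁻¹ * ρ⁻¹, ?_, hne, ?_⟩
  · have h1 : WL p (ℓ + 2 * L) ρ := hw.conj hσ
    exact (((hw.mul h1).mul hw.inv).mul h1.inv).mono (by omega)
  · rcases le_or_gt (2 * (τ.support.card : ℝ) ^ 2 / Fintype.card α) 1 with h | h
    · left
      refine isThreeCycle_commutator hne ?_
      rw [hlam, max_eq_left h] at hcard
      have : ((τ.support ∩ ρ.support).erase (τ x)).card < 1 := by exact_mod_cast hcard
      omega
    · right
      rw [hlam, max_eq_right h.le] at hcard
      have h1 : ((τ * ρ * τ⁻¹ * ρ⁻¹).support.card : ℝ) ≤ 3 * (τ.support ∩ ρ.support).card := by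
        exact_mod_cast card_support_commutator_le τ ρ
      rw [hinter] at h1
      push_cast at h1
      have h2 : 12 * (τ.support.card : ℝ) ^ 2 / Fintype.card α =
        6 * (2 * (τ.support.card : ℝ) ^ 2 / Fintype.card α) := by ring
      rw [h2]
      linarith

lemma exists_threeCycle_of_small_support {p : Bool → Perm α} {L : ℕ} (hp : TwoMix p L) (d : ℕ) :
    ∀ (ℓ : ℕ) (τ : Perm α), τ ≠ 1 → WL p ℓ τ → 24 * τ.support.card ≤ Fintype.card α →
      (12 * (τ.support.card : ℝ) / Fintype.card α) ^ 2 ^ d * Fintype.card α ≤ 1 →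
      ∃ σ : Perm α, σ.IsThreeCycle ∧ WL p (4 ^ (d + 1) * (ℓ + 2 * L)) σ := by
  induction d with
  | zero =>
    intro ℓ τ hτ hw ha hsmall
    exfalso
    have h1 := Perm.one_lt_card_support_of_ne_one hτ
    have hn : (0 : ℝ) < Fintype.card α := by
      have : 0 < Fintype.card α := by omega
      exact_mod_cast this
    rw [pow_zero, pow_one, div_mul_cancel₀ _ hn.ne'] at hsmall
    have : (2 : ℝ) ≤ τ.support.card := by exact_mod_cast h1
    linarith
  | succ d ih =>
    intro ℓ τ hτ hw ha hsmall
    have h1 := Perm.one_lt_card_support_of_ne_one hτ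
    have hn : (0 : ℝ) < Fintype.card α := by
      have : 0 < Fintype.card α := by omega
      exact_mod_cast this
    have hpow : 1 ≤ 4 ^ (d + 1) := Nat.one_le_pow _ _ (by norm_num)
    obtain ⟨τ', hw', hτ', h | h⟩ := exists_commutator_step hp hτ hw ha
    · refine ⟨τ', h, hw'.mono ?_⟩
      rw [pow_succ]
      nlinarith
    · have hb : 12 * (τ'.support.card : ℝ) / Fintype.card α ≤
          (12 * (τ.support.card : ℝ) / Fintype.card α) ^ 2 := by
        calc _ ≤ 12 * (12 * (τ.support.card : ℝ) ^ 2 / Fintype.card α) / Fintype.card α := by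
              gcongr
          _ = _ := by ring
      have ha' : 24 * τ'.support.card ≤ Fintype.card α := by
        have e : (24 : ℝ) * τ.support.card ≤ Fintype.card α := by exact_mod_cast ha
        have e1 : 12 * (τ.support.card : ℝ) / Fintype.card α ≤ 1 / 2 := by
          rw [div_le_iff₀ hn]; linarith
        have e2 : (12 * (τ.support.card : ℝ) / Fintype.card α) ^ 2 ≤ (1 / 2) ^ 2 :=
          pow_le_pow_left₀ (by positivity) e1 2
        have e3 := hb.trans e2
        rw [div_le_iff₀ hn] at e3
        have : (24 : ℝ) * τ'.support.card ≤ Fintype.card α := by linarith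
        exact_mod_cast this
      have hsmall' : (12 * (τ'.support.card : ℝ) / Fintype.card α) ^ 2 ^ d * Fintype.card α ≤ 1 := by
        refine le_trans ?_ hsmall
        rw [pow_succ 2 d, mul_comm (2 ^ d) 2, pow_mul _ 2]
        gcongr
      obtain ⟨σ, h3, hσ⟩ := ih _ τ' hτ' hw' ha' hsmall'
      refine ⟨σ, h3, hσ.mono ?_⟩
      rw [pow_succ 4 (d + 1), mul_assoc]
      refine Nat.mul_le_mul_left _ ?_
      omega

end Commutators

section ThreeCycles
variable {α : Type*} [Fintype α] [DecidableEq α]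

/-- The 3-cycle sending `x` to `y` to `z` to `x`. -/
def c3 (x y z : α) : Perm α := swap x y * swap y z

lemma c3_conj (σ : Perm α) (x y z : α) : σ * c3 x y z * σ⁻¹ = c3 (σ x) (σ y) (σ z) := by
  simp only [c3, swap_apply_apply]; group

lemma c3_rotate {x y z : α} (h1 : x ≠ y) (h2 : y ≠ z) (h3 : x ≠ z) : c3 x y z = c3 y z x := by
  ext t
  simp only [c3, Perm.mul_apply, swap_apply_def]
  split_ifs <;> simp_all

lemma c3_inv {x y z : α} : (c3 x y z)⁻¹ = c3 z y x := by
  rw [c3, mul_inv_rev, swap_inv, swap_inv, c3, swap_comm z y, swap_comm y x]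

lemma exists_eq_c3 {σ : Perm α} (h : σ.IsThreeCycle) :
    ∃ x y z, x ≠ y ∧ y ≠ z ∧ x ≠ z ∧ σ = c3 x y z := by
  obtain ⟨a, ha⟩ : σ.support.Nonempty := by
    rw [← card_pos, h.card_support]; norm_num
  have h1 := h.nodup_iff_mem_support.2 ha
  have h2 := h.eq_swap_mul_swap_iff_mem_support.2 ha
  simp only [List.nodup_cons, List.mem_cons, List.not_mem_nil, or_false, not_or] at h1
  exact ⟨a, σ a, σ (σ a), h1.1.1, h1.2.1, h1.1.2, h2⟩

lemma exists_c3_of_pair {p : Bool → Perm α} {L ℓ : ℕ} (hp : TwoMix p L) {σ : Perm α}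
    (hσ : σ.IsThreeCycle) (hw : WL p ℓ σ) {x y : α} (hxy : x ≠ y) :
    ∃ z, x ≠ z ∧ y ≠ z ∧ WL p (ℓ + 2 * L) (c3 x y z) := by
  obtain ⟨a, b, c, hab, hbc, hac, rfl⟩ := exists_eq_c3 hσ
  obtain ⟨W, _, _, e, he, hmix⟩ := hp
  have hn : (2 : ℝ) ≤ Fintype.card α := by
    have : 1 < Fintype.card α := Fintype.one_lt_card_iff.2 ⟨a, b, hab⟩
    exact_mod_cast this
  have hpos : 0 < pr (fun w => e w a = x ∧ e w b = y) := by
    have h1 := (abs_le.1 (hmix a b x y hab hxy)).1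
    have : 0 < 1 / ((Fintype.card α : ℝ) * (Fintype.card α - 1)) := by
      have : (0 : ℝ) < (Fintype.card α : ℝ) - 1 := by linarith
      positivity
    linarith
  obtain ⟨w, h1, h2⟩ : ∃ w, e w a = x ∧ e w b = y := by
    by_contra hno
    push Not at hno
    have : pr (fun w => e w a = x ∧ e w b = y) ≤ 0 := by
      refine (pr_mono (B := fun _ => False) fun w h => hno w h.1 h.2).trans ?_
      simp [pr]
    linarith
  refine ⟨e w c, ?_, ?_, ?_⟩
  · rw [← h1]; exact fun h => hac ((e w).injective h)
  · rw [← h2]; exact fun h => hbc ((e w).injective h)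
  · rw [← h1, ← h2, ← c3_conj]
    exact hw.conj (he w)

lemma WL_threeCycle_of_exists {p : Bool → Perm α} {L ℓ : ℕ} (hp : TwoMix p L) {σ : Perm α}
    (hσ : σ.IsThreeCycle) (hw : WL p ℓ σ) {τ : Perm α} (hτ : τ.IsThreeCycle) :
    WL p (3 * (ℓ + 2 * L)) τ := by
  obtain ⟨x, y, z, hxy, hyz, hxz, rfl⟩ := exists_eq_c3 hτ
  obtain ⟨z₁, hx1, hy1, hA⟩ := exists_c3_of_pair hp hσ hw hxy
  by_cases hz : z = z₁
  · subst hz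
    exact hA.mono (by omega)
  obtain ⟨q, h1q, hzq, hB⟩ := exists_c3_of_pair hp hσ hw (Ne.symm hz)
  by_cases hqx : q = x
  · subst hqx
    have e : c3 q y z₁ * (c3 z₁ z q)⁻¹ * (c3 q y z₁)⁻¹ = c3 q y z := by
      rw [c3_inv, c3_conj]
      have e1 : c3 q y z₁ q = y := by
        simp [c3, swap_apply_def]; grind
      have e2 : c3 q y z₁ z = z := by
        simp [c3, swap_apply_def]; grind
      have e3 : c3 q y z₁ z₁ = q := by
        simp [c3]
      rw [e1, e2, e3]
      exact (c3_rotate hxy hyz hxz).symm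
    rw [← e]
    exact ((hA.mul hB.inv).mul hA.inv).mono (by omega)
  by_cases hqy : q = y
  · subst hqy
    have e : (c3 x q z₁)⁻¹ * c3 z₁ z q * ((c3 x q z₁)⁻¹)⁻¹ = c3 x q z := by
      rw [c3_conj, c3_inv]
      have e1 : c3 z₁ q x q = x := by
        simp [c3, swap_apply_def]; grind
      have e2 : c3 z₁ q x z = z := by
        simp [c3, swap_apply_def]; grind
      have e3 : c3 z₁ q x z₁ = q := by
        simp [c3, swap_apply_def]; grind
      rw [e1, e2, e3]
      exact (c3_rotate hxy hyz hxz).symm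
    rw [← e]
    exact ((hA.inv.mul hB).mul hA.inv.inv).mono (by omega)
  · have e : c3 z₁ z q * c3 x y z₁ * (c3 z₁ z q)⁻¹ = c3 x y z := by
      rw [c3_conj]
      have e1 : c3 z₁ z q x = x := by
        simp [c3, swap_apply_def]; grind
      have e2 : c3 z₁ z q y = y := by
        simp [c3, swap_apply_def]; grind
      have e3 : c3 z₁ z q z₁ = z := by
        simp [c3, swap_apply_def]; grind
      rw [e1, e2, e3]
    rw [← e]
    exact ((hB.mul hA).mul hB.inv).mono (by omega)

end ThreeCycles

section SingleWalk
variable {α : Type*} [Fintype α] [DecidableEq α]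

/-- The first `T` steps of a single walk, as a path system. -/
def chainSystem (T : ℕ) (u : ℕ → Bool) (x : α) : PathSystem (Fin (T + 1)) α where
  root i := (i : ℕ) = 0
  lab i := u (i - 1)
  src i := ⟨i - 1, by omega⟩
  rank i := i
  pos p i := walk p u x i
  rank_src i hi := by simp only; omega
  pos_root i hi p q := by rw [hi]; rfl
  pos_step i hi p := by
    obtain ⟨k, hk⟩ := Nat.exists_eq_succ_of_ne_zero hi
    simp only [hk]
    rfl

lemma walk_injOn_of_no_coin {T : ℕ} {u : ℕ → Bool} {x : α} {p : Bool → Perm α}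
    (h : ¬ ∃ i j, (chainSystem T u x).Coin p i j) :
    ∀ i ≤ T, ∀ j < i, walk p u x j ≠ walk p u x i := by
  intro i
  induction i using Nat.strong_induction_on with
  | _ i ih =>
    intro hi j hj hji
    refine h ⟨⟨i, by omega⟩, ⟨j, by omega⟩, ⟨?_, ?_⟩, hj, hji⟩
    · simp only [chainSystem]; omega
    · rintro ⟨l, hl⟩ hl0 hli - heq
      simp only [chainSystem] at hl0 hli heq
      exact ih (i - 1) (by omega) (by omega) (l - 1) (by omega) heq

lemma pr_walk_not_injOn_le {T : ℕ} (u : ℕ → Bool) (x : α) (hn : T + 1 < Fintype.card α) :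
    pr (fun p : Bool → Perm α => ¬ ∀ i ≤ T, ∀ j < i, walk p u x j ≠ walk p u x i) ≤
      ((T : ℝ) + 1) ^ 2 / ((Fintype.card α : ℝ) - (T + 1)) := by
  have h := (chainSystem T u x).pr_exists_coin_le (by rwa [Fintype.card_fin])
  rw [Fintype.card_fin] at h
  push_cast at h
  refine (pr_mono fun p hp => ?_).trans h
  by_contra hno
  exact hp (walk_injOn_of_no_coin hno)

/-- The letters of `(h ^ m * g) ^ t`, read from the right. -/
def periodicLetters (m : ℕ) (t : ℕ) : Bool := decide (t % (m + 1) ≠ 0)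

lemma walk_periodic (p : Bool → Perm α) (m : ℕ) (x : α) (t : ℕ) :
    walk p (periodicLetters m) x ((m + 1) * t) = ((p true ^ m * p false) ^ t) x ∧
    walk p (periodicLetters m) x ((m + 1) * t + 1) =
      p false (((p true ^ m * p false) ^ t) x) := by
  have step : ∀ t, walk p (periodicLetters m) x ((m + 1) * t + 1) =
      p false (walk p (periodicLetters m) x ((m + 1) * t)) := by
    intro t
    change p (periodicLetters m ((m + 1) * t)) _ = _
    simp [periodicLetters]
  have inner : ∀ t, ∀ s ≤ m, walk p (periodicLetters m) x ((m + 1) * t + 1 + s) =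
      (p true ^ s) (walk p (periodicLetters m) x ((m + 1) * t + 1)) := by
    intro t s
    induction s with
    | zero => simp
    | succ s ih =>
      intro hs
      change p (periodicLetters m ((m + 1) * t + 1 + s))
        (walk p (periodicLetters m) x ((m + 1) * t + 1 + s)) = _
      have : periodicLetters m ((m + 1) * t + 1 + s) = true := by
        rw [periodicLetters, decide_eq_true_eq, add_assoc, Nat.mul_add_mod,
          Nat.mod_eq_of_lt (by omega)]
        omega
      rw [this, ih (by omega), pow_succ', Perm.mul_apply]
  have main : ∀ t, walk p (periodicLetters m) x ((m + 1) * t) =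
      ((p true ^ m * p false) ^ t) x := by
    intro t
    induction t with
    | zero => rfl
    | succ t ih =>
      have := inner t m le_rfl
      rw [step, ih] at this
      rw [show (m + 1) * (t + 1) = (m + 1) * t + 1 + m by ring, this, pow_succ' _ t]
      rfl
  exact ⟨main t, by rw [step, main]⟩

/-- The orbit of `y` under `h ^ m * g` has no early coincidences. -/
def GenericOrbit (g v : Perm α) (J : ℕ) (y : α) : Prop :=
  (∀ i < J, ∀ j < J, (v ^ i) y = (v ^ j) y → i = j) ∧
    ∀ i < J, ∀ j < J, g ((v ^ i) y) ≠ (v ^ j) y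

lemma pr_not_genericOrbit_le {m J : ℕ} (hm : 1 ≤ m) (y : α)
    (hn : (m + 1) * J + 2 < Fintype.card α) :
    pr (fun p : Bool → Perm α => ¬ GenericOrbit (p false) (p true ^ m * p false) J y) ≤
      (((m + 1) * J + 1 : ℕ) + 1 : ℝ) ^ 2 /
        ((Fintype.card α : ℝ) - (((m + 1) * J + 1 : ℕ) + 1)) := by
  refine (pr_mono fun p hp => ?_).trans (pr_walk_not_injOn_le (periodicLetters m) y hn)
  contrapose! hp
  have hinj : ∀ i ≤ (m + 1) * J + 1, ∀ j ≤ (m + 1) * J + 1,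
      walk p (periodicLetters m) y i = walk p (periodicLetters m) y j → i = j := by
    intro i hi j hj hij
    by_contra hne
    rcases lt_or_gt_of_ne hne with h | h
    · exact hp j hj i h hij
    · exact hp i hi j h hij.symm
  have hle : ∀ i < J, (m + 1) * i + 1 ≤ (m + 1) * J + 1 := fun i hi =>
    Nat.add_le_add_right (Nat.mul_le_mul_left _ hi.le) 1
  refine ⟨fun i hi j hj h => ?_, fun i hi j hj h => ?_⟩
  · rw [← (walk_periodic p m y i).1, ← (walk_periodic p m y j).1] at h
    have := hinj _ (by have := hle i hi; omega) _ (by have := hle j hj; omega) h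
    exact Nat.eq_of_mul_eq_mul_left (Nat.succ_pos m) this
  · rw [← (walk_periodic p m y i).2, ← (walk_periodic p m y j).1] at h
    have := hinj _ (hle i hi) _ (by have := hle j hj; omega) h
    have h2 := congrArg (· % (m + 1)) this
    simp only [Nat.mul_add_mod, Nat.mul_mod_right] at h2
    rw [Nat.mod_eq_of_lt (by omega)] at h2
    omega

end SingleWalk

section FirstReturn
variable {α : Type*} [Fintype α] [DecidableEq α] {k : ℕ}

/-- The permutation `ρ` describes the first returns of `v` to the points `d i`. -/
def IsReturn (v : Perm α) (d : Fin k → α) (ρ : Fin k → Fin k) : Prop :=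
  ∀ i, ∃ t, 1 ≤ t ∧ (v ^ t) (d i) = d (ρ i) ∧ ∀ s, 1 ≤ s → s < t → ∀ j, (v ^ s) (d i) ≠ d j

lemma exists_isReturn (v : Perm α) {d : Fin k → α} (hd : d.Injective) :
    ∃ ρ : Perm (Fin k), IsReturn v d ρ := by
  have h : ∀ i, ∃ t, 1 ≤ t ∧ ∃ j, (v ^ t) (d i) = d j := fun i =>
    ⟨orderOf v, orderOf_pos v, i, by rw [pow_orderOf_eq_one, Perm.one_apply]⟩
  have hs := fun i => Nat.find_spec (h i)
  have hmin : ∀ i s, 1 ≤ s → s < Nat.find (h i) → ∀ j, (v ^ s) (d i) ≠ d j :=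
    fun i s h1 hlt j hj => Nat.find_min (h i) hlt ⟨h1, j, hj⟩
  choose ρ hρ using fun i => (hs i).2
  have key : ∀ i j, Nat.find (h i) ≤ Nat.find (h j) → ρ i = ρ j → i = j := by
    intro i j hle hij
    have e : (v ^ (Nat.find (h j) - Nat.find (h i))) (d j) = d i := by
      apply (v ^ Nat.find (h i)).injective
      rw [← Perm.mul_apply, ← pow_add, Nat.add_sub_cancel' hle, hρ, hρ, hij]
    rcases hle.eq_or_lt with heq | hlt
    · rw [heq, Nat.sub_self, pow_zero, Perm.one_apply] at e
      exact (hd e).symm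
    · exact absurd e (hmin j _ (by omega) (by have := (hs i).1; omega) i)
  have hinj : Function.Injective ρ := by
    intro i j hij
    rcases le_total (Nat.find (h i)) (Nat.find (h j)) with hle | hle
    · exact key i j hle hij
    · exact (key j i hle hij.symm).symm
  exact ⟨Equiv.ofBijective ρ (Finite.injective_iff_bijective.1 hinj),
    fun i => ⟨_, (hs i).1, hρ i, hmin i⟩⟩

/-- The permutation moving `d i` to `d (σ i)` and fixing all other points (trivial if `d` is not
injective). -/
noncomputable def actOn (d : Fin k → α) (σ : Perm (Fin k)) : Perm α :=
  if h : d.Injective then σ.viaEmbedding ⟨d, h⟩ else 1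

lemma actOn_apply {d : Fin k → α} (hd : d.Injective) (σ : Perm (Fin k)) (i : Fin k) :
    actOn d σ (d i) = d (σ i) := by
  rw [actOn, dif_pos hd]
  exact Perm.viaEmbedding_apply σ ⟨d, hd⟩ i

lemma actOn_apply_of_ne {d : Fin k → α} (σ : Perm (Fin k)) {x : α} (h : ∀ i, x ≠ d i) :
    actOn d σ x = x := by
  rw [actOn]
  split_ifs with hd
  · exact Perm.viaEmbedding_apply_of_notMem σ ⟨d, hd⟩ x (by rintro ⟨i, hi⟩; exact h i hi.symm)
  · rfl

lemma actOn_inv (d : Fin k → α) (σ : Perm (Fin k)) : actOn d σ⁻¹ = (actOn d σ)⁻¹ := by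
  unfold actOn
  split_ifs with h
  · exact map_inv (Perm.viaEmbeddingHom ⟨d, h⟩) σ
  · simp

lemma IsReturn.mul_actOn {v : Perm α} {d : Fin k → α} (hd : d.Injective) {ρ : Fin k → Fin k}
    (h : IsReturn v d ρ) (σ : Perm (Fin k)) : IsReturn (v * actOn d σ) d (ρ ∘ σ) := by
  intro i
  obtain ⟨t, ht, hret, hfirst⟩ := h (σ i)
  have key : ∀ s, s + 1 ≤ t → ((v * actOn d σ) ^ (s + 1)) (d i) = (v ^ (s + 1)) (d (σ i)) := by
    intro s
    induction s with
    | zero => intro _; simp [actOn_apply hd]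
    | succ s ih =>
      intro hs
      rw [pow_succ', Perm.mul_apply, ih (by omega), Perm.mul_apply,
        actOn_apply_of_ne σ (hfirst (s + 1) (by omega) (by omega)), pow_succ' _ (s + 1),
        Perm.mul_apply]
  refine ⟨t, ht, ?_, fun s h1 hs j => ?_⟩
  · obtain ⟨s, rfl⟩ := Nat.exists_eq_succ_of_ne_zero (show t ≠ 0 by omega)
    rw [Nat.succ_eq_add_one, key s le_rfl, hret]
    rfl
  · obtain ⟨s, rfl⟩ := Nat.exists_eq_succ_of_ne_zero (show s ≠ 0 by omega)
    rw [Nat.succ_eq_add_one, key s hs.le]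
    exact hfirst _ h1 hs j

lemma IsReturn.sameCycle_iff {v : Perm α} {d : Fin k → α} (hd : d.Injective) {ρ : Perm (Fin k)}
    (h : IsReturn v d ρ) (i j : Fin k) : v.SameCycle (d i) (d j) ↔ ρ.SameCycle i j := by
  constructor
  · intro hs
    obtain ⟨m, -, hm⟩ := hs.exists_pow_eq'
    clear hs
    induction m using Nat.strong_induction_on generalizing i with
    | _ m ih =>
      rcases Nat.eq_zero_or_pos m with rfl | hpos
      · rw [pow_zero, Perm.one_apply] at hm
        rw [hd hm]
      · obtain ⟨t, ht, hret, hfirst⟩ := h i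
        have htm : t ≤ m := by
          by_contra hlt
          exact hfirst m hpos (by omega) j hm
        have := ih (m - t) (by omega) (ρ i) (by
          rw [← hret, ← Perm.mul_apply, ← pow_add, Nat.sub_add_cancel htm, hm])
        exact Perm.sameCycle_apply_left.1 this
  · intro hs
    obtain ⟨m, -, hm⟩ := hs.exists_pow_eq'
    clear hs
    induction m generalizing i with
    | zero =>
      rw [pow_zero, Perm.one_apply] at hm
      rw [hm]
    | succ m ih =>
      obtain ⟨t, -, hret, -⟩ := h i
      have := ih (ρ i) (by rw [← hm, pow_succ, Perm.mul_apply])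
      rw [← hret] at this
      exact Perm.sameCycle_pow_left.1 this

lemma pr_full_cycle (hk : 2 ≤ k) :
    pr (fun σ : Perm (Fin k) => ∀ i j, σ.SameCycle i j) = 1 / k := by
  have h : ∀ σ : Perm (Fin k), (∀ i j, σ.SameCycle i j) ↔ σ.cycleType = {k} := by
    intro σ
    constructor
    · intro hσ
      have hne : ∀ i, σ i ≠ i := by
        intro i hi
        obtain ⟨j, hj⟩ : ∃ j : Fin k, j ≠ i := by
          have : Nontrivial (Fin k) := Fin.nontrivial_iff_two_le.2 hk
          exact exists_ne i
        exact hj ((hσ i j).eq_of_left hi).symm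
      have hc : σ.IsCycle := ⟨⟨0, by omega⟩, hne _, fun y _ => hσ _ _⟩
      rw [hc.cycleType]
      have : σ.support = univ := by ext i; simp [hne]
      rw [this, card_univ, Fintype.card_fin]
    · intro hσ i j
      have hc : σ.IsCycle := by
        rw [← Perm.card_cycleType_eq_one, hσ, Multiset.card_singleton]
      have hcard : σ.support.card = k := by
        rw [← Perm.sum_cycleType, hσ, Multiset.sum_singleton]
      have hu : σ.support = univ := by
        rw [← card_eq_iff_eq_univ, hcard, Fintype.card_fin]
      have hm : ∀ i, σ i ≠ i := fun i => Perm.mem_support.1 (by rw [hu]; exact mem_univ i)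
      exact hc.sameCycle (hm i) (hm j)
  have := Perm.card_of_cycleType_singleton (α := Fin k) hk (by rw [Fintype.card_fin])
  rw [Fintype.card_fin, Nat.choose_self, mul_one] at this
  have e : pr (fun σ : Perm (Fin k) => σ.cycleType = {k}) =
      ((k - 1).factorial : ℝ) / k.factorial := by
    rw [pr_eq_card, Fintype.card_perm, Fintype.card_fin, ← this]
    congr!
  rw [pr_congr h, e, ← Nat.mul_factorial_pred (by omega : k ≠ 0)]
  have h1 : ((k - 1).factorial : ℝ) ≠ 0 := by positivity
  have h2 : (k : ℝ) ≠ 0 := by positivity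
  push_cast
  field_simp

lemma pr_sameCycle_mul_actOn (hk : 2 ≤ k) (v : Perm α) {d : Fin k → α} (hd : d.Injective) :
    pr (fun σ : Perm (Fin k) => ∀ i j, (v * actOn d σ).SameCycle (d i) (d j)) = 1 / k := by
  obtain ⟨ρ, hρ⟩ := exists_isReturn v hd
  rw [← pr_full_cycle hk, ← pr_equiv (Equiv.mulLeft ρ) (fun σ => ∀ i j, σ.SameCycle i j)]
  refine pr_congr fun σ => forall_congr' fun i => forall_congr' fun j => ?_
  have := hρ.mul_actOn hd σ
  exact IsReturn.sameCycle_iff (ρ := ρ * σ) hd this i j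

/-- If `G` and `d` are not affected by permuting the outputs of `v` at the points `d v`, then on
`G` these points lie on a single cycle with probability `1 / k`. -/
lemma pr_and_sameCycle (hk : 2 ≤ k) (G : Perm α → Prop) (d : Perm α → Fin k → α)
    (hinj : ∀ v, G v → (d v).Injective)
    (hG : ∀ v, G v → ∀ σ, G (v * actOn (d v) σ))
    (hd : ∀ v, G v → ∀ σ, d (v * actOn (d v) σ) = d v) :
    pr (fun v => G v ∧ ∀ i j, v.SameCycle (d v i) (d v j)) = 1 / k * pr G := by
  have hshift : ∀ σ : Perm (Fin k), pr (fun v => G v ∧ ∀ i j, v.SameCycle (d v i) (d v j)) =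
      pr (fun v => G v ∧ ∀ i j, (v * actOn (d v) σ).SameCycle (d v i) (d v j)) := by
    intro σ
    rw [pr_eq_card, pr_eq_card]
    congr 2
    symm
    refine card_bij' (fun v _ => v * actOn (d v) σ) (fun v _ => v * actOn (d v) σ⁻¹) ?_ ?_ ?_ ?_
    · intro v hv
      simp only [mem_filter, mem_univ, true_and] at hv ⊢
      rw [hd v hv.1]
      exact ⟨hG v hv.1 σ, hv.2⟩
    · intro v hv
      simp only [mem_filter, mem_univ, true_and] at hv ⊢
      rw [hd v hv.1, actOn_inv, inv_mul_cancel_right]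
      exact ⟨actOn_inv (d v) σ ▸ hG v hv.1 σ⁻¹, hv.2⟩
    · intro v hv
      simp only [mem_filter, mem_univ, true_and] at hv ⊢
      rw [hd v hv.1, actOn_inv, mul_inv_cancel_right]
    · intro v hv
      simp only [mem_filter, mem_univ, true_and] at hv ⊢
      rw [hd v hv.1, actOn_inv, inv_mul_cancel_right]
  have havg : pr (fun v => G v ∧ ∀ i j, v.SameCycle (d v i) (d v j)) =
      pr (fun q : Perm α × Perm (Fin k) => G q.1 ∧
        ∀ i j, (q.1 * actOn (d q.1) q.2).SameCycle (d q.1 i) (d q.1 j)) := by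
    rw [pr_swap, pr_prod_eq_expect]
    simp only [← hshift]
    rw [Finset.expect_const univ_nonempty]
  rw [havg, pr_prod_eq_expect, pr, Finset.mul_expect]
  refine Finset.expect_congr rfl fun v _ => ?_
  by_cases hv : G v
  · simp only [hv, true_and, if_true, mul_one]
    exact pr_sameCycle_mul_actOn hk v (hinj v hv)
  · simp [hv, pr]

end FirstReturn

section ProductProbability
variable {Ω Ω' : Type*} [Fintype Ω] [Fintype Ω']

lemma expect_pr_comm (A : Ω → Ω' → Prop) :
    𝔼 ω, pr (fun ω' => A ω ω') = 𝔼 ω', pr (fun ω => A ω ω') :=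
  Finset.expect_comm _ _ _

lemma pr_mul_pr (A : Ω → Prop) (B : Ω' → Prop) :
    pr A * pr B = pr (fun q : Ω × Ω' => A q.1 ∧ B q.2) := by
  rw [pr_prod_eq_expect, pr, Finset.expect_mul]
  refine Finset.expect_congr rfl fun ω _ => ?_
  by_cases h : A ω <;> simp [h, pr]

lemma pr_eq_of_unique {β : Type*} [Fintype β] {A : β → Prop} (b : β) (h : ∀ a, A a → a = b) :
    pr A ≤ 1 / Fintype.card β := by
  rw [pr_eq_card]
  gcongr
  have : (univ.filter A).card ≤ 1 := card_le_one.2 fun a ha a' ha' =>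
    (h a (mem_filter.1 ha).2).trans (h a' (mem_filter.1 ha').2).symm
  exact_mod_cast this

variable {α : Type*} [Fintype α]

lemma pr_tuple_le {k : ℕ} (j : Fin k) {A : (Fin k → α) → Prop} {c : ℝ} (hc : 0 ≤ c)
    (h : ∀ z, pr (fun a => A (Function.update z j a)) ≤ c) : pr A ≤ c := by
  rw [← pr_equiv (Equiv.funSplitAt j α).symm, pr_swap]
  refine pr_prod_le hc fun f => ?_
  rcases isEmpty_or_nonempty α with hα | ⟨⟨a₀⟩⟩
  · simpa [pr, Finset.univ_eq_empty] using hc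
  refine le_trans (le_of_eq (pr_congr fun a => ?_))
    (h ((Equiv.funSplitAt j α).symm (a₀, f)))
  have : (Equiv.funSplitAt j α).symm (a, f) =
      Function.update ((Equiv.funSplitAt j α).symm (a₀, f)) j a := by
    ext i
    by_cases hi : i = j
    · subst hi; simp [Equiv.funSplitAt]
    · simp [Equiv.funSplitAt, hi]
  simp only [this]

lemma pr_tuple_eq_le {k : ℕ} (σ τ : Perm α) {i j : Fin k} (hij : i ≠ j) :
    pr (fun z : Fin k → α => σ (z i) = τ (z j)) ≤ 1 / Fintype.card α := by
  refine pr_tuple_le j (by positivity) fun z => ?_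
  refine pr_eq_of_unique (τ⁻¹ (σ (z i))) fun a ha => ?_
  rw [Function.update_of_ne hij, Function.update_self] at ha
  rw [ha, Perm.inv_def, Equiv.symm_apply_apply]

lemma pr_exists_tuple_eq_le {k J : ℕ} (σ : ℕ → Perm α) :
    pr (fun z : Fin k → α => ∃ i j, i ≠ j ∧ ∃ s < J, ∃ t < J, σ s (z i) = σ t (z j)) ≤
      (k : ℝ) ^ 2 * J ^ 2 / Fintype.card α := by
  refine (pr_mono (B := fun z => ∃ q : (Fin k × Fin k) × (Fin J × Fin J), q.1.1 ≠ q.1.2 ∧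
    σ q.2.1 (z q.1.1) = σ q.2.2 (z q.1.2)) ?_).trans ((pr_exists_le _).trans ?_)
  · rintro z ⟨i, j, hij, s, hs, t, ht, h⟩
    exact ⟨((i, j), (⟨s, hs⟩, ⟨t, ht⟩)), hij, h⟩
  · refine (Finset.sum_le_sum (g := fun _ => 1 / (Fintype.card α : ℝ)) fun q _ => ?_).trans
      (le_of_eq ?_)
    · by_cases hq : q.1.1 = q.1.2
      · refine (pr_mono (B := fun _ => False) fun z h => h.1 hq).trans ?_
        simp only [pr, if_false, Finset.expect_const_zero]
        positivity
      · exact (pr_mono fun z h => h.2).trans (pr_tuple_eq_le _ _ hq)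
    · rw [sum_const, card_univ]
      simp only [Fintype.card_prod, Fintype.card_fin, nsmul_eq_mul]
      push_cast; ring

lemma pr_not_injective_le {k : ℕ} :
    pr (fun z : Fin k → α => ¬ z.Injective) ≤ (k : ℝ) ^ 2 / Fintype.card α := by
  have := pr_exists_tuple_eq_le (α := α) (k := k) (J := 1) (fun _ => 1)
  rw [Nat.cast_one, one_pow, mul_one] at this
  refine (pr_mono fun z hz => ?_).trans this
  rw [Function.Injective] at hz
  push Not at hz
  obtain ⟨i, j, h, hij⟩ := hz
  exact ⟨i, j, hij, 0, one_pos, 0, one_pos, h⟩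

end ProductProbability

section CommonCycle
variable {α : Type*} [Fintype α] [DecidableEq α]

/-- All entries of `z` lie on the same cycle of `u`. -/
def OneCycle {k : ℕ} (u : Perm α) (z : Fin k → α) : Prop := ∀ i j, u.SameCycle (z i) (z j)

/-- The probability that `k` random points lie on the same cycle of `u`. -/
noncomputable def cyc (k : ℕ) (u : Perm α) : ℝ := pr (fun z : Fin k → α => OneCycle u z)

lemma cyc_nonneg (k : ℕ) (u : Perm α) : 0 ≤ cyc k u := pr_nonneg _

lemma cyc_le_one (k : ℕ) (u : Perm α) : cyc k u ≤ 1 := pr_le_one _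

lemma pr_oneCycle {k : ℕ} (hk : 2 ≤ k) {z : Fin k → α} (hz : z.Injective) :
    pr (fun u : Perm α => OneCycle u z) = 1 / k := by
  have h := pr_and_sameCycle hk (fun _ : Perm α => True) (fun _ => z) (fun _ _ => hz)
    (fun _ _ _ => trivial) (fun _ _ _ => rfl)
  have h1 : pr (fun _ : Perm α => True) = 1 := by
    simp [pr]
  rw [h1, mul_one] at h
  rw [← h]
  exact pr_congr fun u => by simp [OneCycle]

lemma le_expect_cyc {k : ℕ} (hk : 2 ≤ k) [Nonempty α] :
    1 / (k : ℝ) - k / Fintype.card α ≤ 𝔼 u : Perm α, cyc k u := by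
  unfold cyc
  rw [expect_pr_comm]
  have hk0 : (0 : ℝ) < k := by positivity
  calc 1 / (k : ℝ) - k / Fintype.card α
      = 1 / k * (1 - (k : ℝ) ^ 2 / Fintype.card α) := by field_simp
    _ ≤ 1 / k * (1 - pr (fun z : Fin k → α => ¬ z.Injective)) := by
        gcongr; exact pr_not_injective_le
    _ = 1 / k * pr (fun z : Fin k → α => z.Injective) := by
        rw [← pr_compl]; simp only [not_not]
    _ = 𝔼 z : Fin k → α, 1 / k * (if z.Injective then (1 : ℝ) else 0) := by
        rw [pr, Finset.mul_expect]
        congr!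
    _ ≤ _ := by
        refine Finset.expect_le_expect fun z _ => ?_
        split_ifs with hz
        · rw [pr_oneCycle hk hz, mul_one]
        · rw [mul_zero]; exact pr_nonneg _

lemma expect_cyc_le {k : ℕ} (hk : 2 ≤ k) [Nonempty α] :
    𝔼 u : Perm α, cyc k u ≤ 1 / (k : ℝ) + (k : ℝ) ^ 2 / Fintype.card α := by
  unfold cyc
  rw [expect_pr_comm]
  have hk0 : (0 : ℝ) < k := by positivity
  calc _ ≤ 𝔼 z : Fin k → α, (1 / (k : ℝ) + if ¬ z.Injective then (1 : ℝ) else 0) := by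
        refine Finset.expect_le_expect fun z _ => ?_
        by_cases hz : z.Injective
        · rw [pr_oneCycle hk hz]; simp [hz]
        · simp only [hz, not_false_eq_true, if_true]
          have := pr_le_one (fun u : Perm α => OneCycle u z)
          have : 0 ≤ 1 / (k : ℝ) := by positivity
          linarith
    _ = 1 / (k : ℝ) + pr (fun z : Fin k → α => ¬ z.Injective) := by
        rw [Finset.expect_add_distrib, Finset.expect_const univ_nonempty, pr]
        congr!
    _ ≤ _ := by gcongr; exact pr_not_injective_le

/-- A long generic orbit of `r * u` is unlikely to stay within one cycle of `u`. -/
lemma pr_generic_and_oneCycle_le {J : ℕ} (hJ : 2 ≤ J) (r : Perm α) (y : α) :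
    pr (fun u : Perm α => GenericOrbit u (r * u) J y ∧
      OneCycle u (fun i : Fin J => ((r * u) ^ (i : ℕ)) y)) ≤ 1 / J := by
  set d : Perm α → Fin J → α := fun u i => u (((r * u) ^ (i : ℕ)) y)
  have hpath : ∀ u, GenericOrbit u (r * u) J y → ∀ σ, ∀ i ≤ J,
      ((r * (u * actOn (d u) σ)) ^ i) y = ((r * u) ^ i) y := by
    intro u hu σ i
    induction i with
    | zero => intro _; rfl
    | succ i ih =>
      intro hi
      rw [pow_succ', Perm.mul_apply, ih (by omega), pow_succ' (r * u), Perm.mul_apply,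
        Perm.mul_apply, Perm.mul_apply, actOn_apply_of_ne]
      · rfl
      · intro j h
        exact hu.2 j j.2 i hi h.symm
  have hval : ∀ u, GenericOrbit u (r * u) J y → ∀ σ, ∀ i < J,
      (u * actOn (d u) σ) (((r * u) ^ i) y) = u (((r * u) ^ i) y) := by
    intro u hu σ i hi
    rw [Perm.mul_apply, actOn_apply_of_ne]
    intro j h
    exact hu.2 j j.2 i hi h.symm
  have h := pr_and_sameCycle hJ (fun u => GenericOrbit u (r * u) J y) d ?_ ?_ ?_
  · refine (pr_mono ?_).trans (h.le.trans ?_)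
    · rintro u ⟨hu, h⟩
      refine ⟨hu, fun i j => ?_⟩
      exact Perm.sameCycle_apply_left.2 (Perm.sameCycle_apply_right.2 (h i j))
    · have := pr_le_one (fun u => GenericOrbit u (r * u) J y)
      have h2 : 0 ≤ 1 / (J : ℝ) := by positivity
      nlinarith
  · intro u hu i j hij
    exact Fin.ext (hu.1 i i.2 j j.2 (u.injective hij))
  · intro u hu σ
    refine ⟨fun i hi j hj hij => ?_, fun i hi j hj hij => ?_⟩
    · rw [hpath u hu σ i hi.le, hpath u hu σ j hj.le] at hij
      exact hu.1 i hi j hj hij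
    · rw [hpath u hu σ i hi.le, hpath u hu σ j hj.le, hval u hu σ i hi] at hij
      exact hu.2 i hi j hj hij
  · intro u hu σ
    funext i
    simp only [d]
    rw [hpath u hu σ i i.2.le]
    exact hval u hu σ i i.2

end CommonCycle

section Exits
variable {α : Type*} [Fintype α] [DecidableEq α]

/-- The orbit of `y` under `v` leaves the cycle of `x` under `u` at `e`, within `J` steps. -/
def IsExit (u v : Perm α) (J : ℕ) (x y e : α) : Prop :=
  ∃ t < J, (v ^ t) y = e ∧ ¬ u.SameCycle x e ∧ ∀ s < t, u.SameCycle x ((v ^ s) y)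

lemma IsExit.unique {u v : Perm α} {J : ℕ} {x y e e' : α} (h : IsExit u v J x y e)
    (h' : IsExit u v J x y e') : e = e' := by
  obtain ⟨t, -, rfl, hne, hlt⟩ := h
  obtain ⟨t', -, rfl, hne', hlt'⟩ := h'
  rcases lt_trichotomy t t' with h | rfl | h
  · exact absurd (hlt' t h) hne
  · rfl
  · exact absurd (hlt t' h) hne'

lemma exists_isExit {u v : Perm α} {J : ℕ} {x y : α}
    (h : ∃ t < J, ¬ u.SameCycle x ((v ^ t) y)) : ∃ e, IsExit u v J x y e := by
  have h' : ∃ t, ¬ u.SameCycle x ((v ^ t) y) := by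
    obtain ⟨t, -, ht⟩ := h; exact ⟨t, ht⟩
  obtain ⟨t, htJ, ht⟩ := h
  exact ⟨_, Nat.find h', (Nat.find_min' h' ht).trans_lt htJ, rfl, Nat.find_spec h',
    fun s hs => not_not.1 (Nat.find_min h' hs)⟩

lemma sameCycle_iff_of_eqOn {u w : Perm α} {x : α} (h : ∀ y, u.SameCycle x y → w y = u y)
    (y : α) : w.SameCycle x y ↔ u.SameCycle x y := by
  have hp : ∀ n : ℕ, (w ^ n) x = (u ^ n) x := by
    intro n
    induction n with
    | zero => rfl
    | succ n ih =>
      rw [pow_succ', Perm.mul_apply, ih, pow_succ', Perm.mul_apply]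
      exact h _ (Perm.sameCycle_pow_right.2 (Perm.SameCycle.refl _ _))
  constructor
  · intro hs
    obtain ⟨n, -, rfl⟩ := hs.exists_pow_eq'
    rw [hp]
    exact Perm.sameCycle_pow_right.2 (Perm.SameCycle.refl _ _)
  · intro hs
    obtain ⟨n, -, rfl⟩ := hs.exists_pow_eq'
    rw [← hp]
    exact Perm.sameCycle_pow_right.2 (Perm.SameCycle.refl _ _)

/-- The exit point, or `y` itself if there is none. -/
noncomputable def exitPoint (u v : Perm α) (J : ℕ) (x y : α) : α :=
  if h : ∃ e, IsExit u v J x y e then h.choose else y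

lemma isExit_exitPoint {u v : Perm α} {J : ℕ} {x y : α} (h : ∃ e, IsExit u v J x y e) :
    IsExit u v J x y (exitPoint u v J x y) := by
  rw [exitPoint, dif_pos h]
  exact h.choose_spec

lemma pr_oneCycle_oneCycle_exit_le {k : ℕ} (hk : 2 ≤ k) (J : ℕ) (r : Perm α) (x : α)
    {z z' : Fin k → α} (hx : ∃ i, z i = x) :
    pr (fun u : Perm α => (OneCycle u z ∧
      (∀ i, ∃ e, IsExit u (r * u) J x (z' i) e) ∧
      Function.Injective (fun i => exitPoint u (r * u) J x (z' i))) ∧ OneCycle (r * u) z') ≤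
      1 / k * pr (fun u : Perm α => OneCycle u z) := by
  obtain ⟨i₀, rfl⟩ := hx
  set x := z i₀
  set G : Perm α → Prop := fun v => OneCycle (r⁻¹ * v) z ∧
    (∀ i, ∃ e, IsExit (r⁻¹ * v) v J x (z' i) e) ∧
    Function.Injective (fun i => exitPoint (r⁻¹ * v) v J x (z' i))
  set d : Perm α → Fin k → α := fun v i => exitPoint (r⁻¹ * v) v J x (z' i)
  have hfix : ∀ v, G v → ∀ σ, ∀ y, (r⁻¹ * v).SameCycle x y → actOn (d v) σ y = y := by
    intro v hv σ y hy
    refine actOn_apply_of_ne σ fun i hi => ?_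
    obtain ⟨t, -, -, hne, -⟩ := isExit_exitPoint (hv.2.1 i)
    rw [show y = exitPoint (r⁻¹ * v) v J x (z' i) from hi] at hy
    exact hne hy
  have hsame : ∀ v, G v → ∀ σ, ∀ y, (r⁻¹ * (v * actOn (d v) σ)).SameCycle x y ↔
      (r⁻¹ * v).SameCycle x y := by
    intro v hv σ
    refine sameCycle_iff_of_eqOn fun y hy => ?_
    rw [Perm.mul_apply, Perm.mul_apply, hfix v hv σ y hy, Perm.mul_apply]
  have hexit : ∀ v, G v → ∀ σ i,
      IsExit (r⁻¹ * (v * actOn (d v) σ)) (v * actOn (d v) σ) J x (z' i) (d v i) := by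
    intro v hv σ i
    obtain ⟨t, ht, he, hne, hlt⟩ := isExit_exitPoint (hv.2.1 i)
    have hp : ∀ s ≤ t, ((v * actOn (d v) σ) ^ s) (z' i) = (v ^ s) (z' i) := by
      intro s
      induction s with
      | zero => intro _; rfl
      | succ s ih =>
        intro hs
        rw [pow_succ', Perm.mul_apply, ih (by omega), Perm.mul_apply,
          hfix v hv σ _ (hlt s (by omega)), pow_succ', Perm.mul_apply]
    refine ⟨t, ht, ?_, ?_, fun s hs => ?_⟩
    · rw [hp t le_rfl, he]
    · rwa [hsame v hv σ]
    · rw [hsame v hv σ, hp s hs.le]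
      exact hlt s hs
  have hdd : ∀ v, G v → ∀ σ, d (v * actOn (d v) σ) = d v := by
    intro v hv σ
    funext i
    exact (isExit_exitPoint ⟨_, hexit v hv σ i⟩).unique (hexit v hv σ i)
  have h := pr_and_sameCycle hk G d (fun v hv => hv.2.2) ?_ hdd
  · have e1 : ∀ u, r⁻¹ * Equiv.mulLeft r u = u := fun u => by simp
    rw [← pr_equiv (Equiv.mulLeft r) G] at h
    rw [← pr_equiv (Equiv.mulLeft r)
      (fun v => G v ∧ ∀ i j, v.SameCycle (d v i) (d v j))] at h
    refine (pr_mono ?_).trans (h.le.trans ?_)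
    · rintro u ⟨hu, h2⟩
      have hGu : G (Equiv.mulLeft r u) := by
        simp only [G, e1]
        exact hu
      refine ⟨hGu, fun i j => ?_⟩
      obtain ⟨s, -, hs, -⟩ := isExit_exitPoint (hGu.2.1 i)
      obtain ⟨t, -, ht, -⟩ := isExit_exitPoint (hGu.2.1 j)
      simp only [d]
      rw [← hs, ← ht]
      exact Perm.sameCycle_pow_left.2 (Perm.sameCycle_pow_right.2 (h2 i j))
    · gcongr
      refine pr_mono fun u hu => ?_
      have := hu.1
      rwa [e1] at this
  · intro v hv σ
    refine ⟨fun i j => ?_, fun i => ⟨_, hexit v hv σ i⟩, ?_⟩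
    · have key : ∀ i, (r⁻¹ * (v * actOn (d v) σ)).SameCycle x (z i) := fun i =>
        (hsame v hv σ _).2 (hv.1 i₀ i)
      exact (key i).symm.trans (key j)
    · have := hdd v hv σ
      change Function.Injective (d (v * actOn (d v) σ))
      rw [this]
      exact hv.2.2

lemma pr_oneCycle_oneCycle_le {k : ℕ} (hk : 2 ≤ k) {J : ℕ} (hJ : 2 ≤ J) (r : Perm α)
    (z z' : Fin k → α) :
    pr (fun u : Perm α => OneCycle u z ∧ OneCycle (r * u) z') ≤
      1 / k * pr (fun u : Perm α => OneCycle u z) +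
      (∑ i, (1 / J + pr (fun u : Perm α => ¬ GenericOrbit u (r * u) J (z' i))) +
      pr (fun u : Perm α => ∃ i j, i ≠ j ∧ ∃ s < J, ∃ t < J,
        ((r * u) ^ s) (z' i) = ((r * u) ^ t) (z' j))) := by
  have hx : ∃ i, z i = z ⟨0, by omega⟩ := ⟨_, rfl⟩
  set x := z ⟨0, by omega⟩
  have h1 := pr_oneCycle_oneCycle_exit_le hk J r x (z' := z') hx
  refine le_trans (pr_mono (B := fun u => ((OneCycle u z ∧
      (∀ i, ∃ e, IsExit u (r * u) J x (z' i) e) ∧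
      Function.Injective (fun i => exitPoint u (r * u) J x (z' i))) ∧ OneCycle (r * u) z') ∨
      ((∃ i, (¬ ∃ e, IsExit u (r * u) J x (z' i) e)) ∨ (∃ i j, i ≠ j ∧ ∃ s < J, ∃ t < J,
        ((r * u) ^ s) (z' i) = ((r * u) ^ t) (z' j)))) ?_)
    ((pr_or_le _ _).trans (add_le_add h1 ((pr_or_le _ _).trans (add_le_add
      ((pr_exists_le _).trans (Finset.sum_le_sum fun i _ => ?_)) le_rfl))))
  · rintro u ⟨hz, hz'⟩
    by_cases hex : ∀ i, ∃ e, IsExit u (r * u) J x (z' i) e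
    · by_cases hinj : Function.Injective (fun i => exitPoint u (r * u) J x (z' i))
      · exact Or.inl ⟨⟨hz, hex, hinj⟩, hz'⟩
      · refine Or.inr (Or.inr ?_)
        rw [Function.Injective] at hinj
        push Not at hinj
        obtain ⟨i, j, he, hij⟩ := hinj
        obtain ⟨s, hs, hs', -⟩ := isExit_exitPoint (hex i)
        obtain ⟨t, ht, ht', -⟩ := isExit_exitPoint (hex j)
        exact ⟨i, j, hij, s, hs, t, ht, by rw [hs', ht', he]⟩
    · rw [not_forall] at hex
      exact Or.inr (Or.inl hex)
  · refine le_trans (pr_mono (B := fun u => (GenericOrbit u (r * u) J (z' i) ∧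
      OneCycle u (fun j : Fin J => ((r * u) ^ (j : ℕ)) (z' i))) ∨
      ¬ GenericOrbit u (r * u) J (z' i)) ?_) ((pr_or_le _ _).trans
        (add_le_add (pr_generic_and_oneCycle_le hJ r (z' i)) le_rfl))
    intro u hu
    by_cases hg : GenericOrbit u (r * u) J (z' i)
    · refine Or.inl ⟨hg, ?_⟩
      have key : ∀ t < J, u.SameCycle x (((r * u) ^ t) (z' i)) := by
        intro t ht
        by_contra hcon
        exact hu (exists_isExit ⟨t, ht, hcon⟩)
      exact fun a b => (key a a.2).symm.trans (key b b.2)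
    · exact Or.inr hg

end Exits

section Covariance
variable {α : Type*} [Fintype α] [DecidableEq α]

lemma expect_cyc_mul_cyc_le {k : ℕ} (hk : 2 ≤ k) {J : ℕ} (hJ : 2 ≤ J) (r : Perm α) [Nonempty α] :
    𝔼 u : Perm α, cyc k u * cyc k (r * u) ≤
      1 / k * (𝔼 u : Perm α, cyc k u) + (k / J + (k : ℝ) ^ 2 * J ^ 2 / Fintype.card α) +
      𝔼 z : Fin k → α, ∑ i, pr (fun u : Perm α => ¬ GenericOrbit u (r * u) J (z i)) := by
  have e : ∀ u : Perm α, cyc k u * cyc k (r * u) =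
      pr (fun q : (Fin k → α) × (Fin k → α) => OneCycle u q.1 ∧ OneCycle (r * u) q.2) :=
    fun u => pr_mul_pr _ _
  simp only [e]
  rw [expect_pr_comm]
  refine (Finset.expect_le_expect fun q _ => pr_oneCycle_oneCycle_le hk hJ r q.1 q.2).trans ?_
  rw [Finset.expect_add_distrib, Finset.expect_add_distrib]
  rw [← Finset.univ_product_univ, Finset.expect_product, Finset.expect_product,
    Finset.expect_product]
  simp only [Finset.expect_const univ_nonempty]
  rw [← Finset.mul_expect]
  simp only [Finset.sum_add_distrib, Finset.expect_add_distrib,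
    Finset.expect_const univ_nonempty, sum_const, card_univ, Fintype.card_fin, nsmul_eq_mul]
  have e2 : 𝔼 z : Fin k → α, pr (fun u : Perm α => OneCycle u z) = 𝔼 u : Perm α, cyc k u :=
    expect_pr_comm fun z u => OneCycle u z
  have h3 : 𝔼 z : Fin k → α, pr (fun u : Perm α => ∃ i j, i ≠ j ∧ ∃ s < J, ∃ t < J,
        ((r * u) ^ s) (z i) = ((r * u) ^ t) (z j)) ≤ (k : ℝ) ^ 2 * J ^ 2 / Fintype.card α := by
    rw [expect_pr_comm]
    exact Finset.expect_le univ_nonempty fun u _ => pr_exists_tuple_eq_le _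
  rw [e2, mul_one_div]
  linarith

lemma expect_bool_fun {β : Type*} [Fintype β] (f : β → β → ℝ) :
    𝔼 p : Bool → β, f (p false) (p true) = 𝔼 h : β, 𝔼 g : β, f g h := by
  rw [Fintype.expect_equiv (Equiv.boolArrowEquivProd β) (fun p => f (p false) (p true))
    (fun q => f q.1 q.2) fun p => rfl, ← Finset.univ_product_univ, Finset.expect_product,
    Finset.expect_comm]

lemma pr_bool_fun {β : Type*} [Fintype β] (A : β → β → Prop) :
    pr (fun p : Bool → β => A (p false) (p true)) = 𝔼 h : β, pr (fun g => A g h) :=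
  expect_bool_fun fun g h => if A g h then (1 : ℝ) else 0

/-- Near-independence of `g` and `h ^ m * g` for the statistic `cyc k`. -/
lemma expect_cyc_mul_cyc_pow_le {k : ℕ} (hk : 2 ≤ k) {J : ℕ} (hJ : 2 ≤ J) {m : ℕ} (hm : 1 ≤ m)
    (hn : (m + 1) * J + 2 < Fintype.card α) :
    𝔼 p : Bool → Perm α, cyc k (p false) * cyc k (p true ^ m * p false) ≤
      1 / k * (𝔼 u : Perm α, cyc k u) + (k / J + (k : ℝ) ^ 2 * J ^ 2 / Fintype.card α) +
      k * ((((m + 1) * J + 1 : ℕ) + 1 : ℝ) ^ 2 /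
        ((Fintype.card α : ℝ) - (((m + 1) * J + 1 : ℕ) + 1))) := by
  have hne : Nonempty α := Fintype.card_pos_iff.1 (by omega)
  rw [expect_bool_fun (fun g h : Perm α => cyc k g * cyc k (h ^ m * g))]
  refine (Finset.expect_le_expect fun h _ => expect_cyc_mul_cyc_le hk hJ (h ^ m)).trans ?_
  rw [Finset.expect_add_distrib, Finset.expect_const univ_nonempty, Finset.expect_comm]
  gcongr
  refine Finset.expect_le univ_nonempty fun z _ => ?_
  rw [Finset.expect_sum_comm]
  refine (Finset.sum_le_sum (g := fun _ => (((m + 1) * J + 1 : ℕ) + 1 : ℝ) ^ 2 /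
        ((Fintype.card α : ℝ) - (((m + 1) * J + 1 : ℕ) + 1))) fun i _ => ?_).trans
    (le_of_eq (by rw [sum_const, card_univ, Fintype.card_fin, nsmul_eq_mul]))
  refine le_trans (le_of_eq ?_) (pr_not_genericOrbit_le hm (z i) hn)
  exact (pr_bool_fun fun g h => ¬ GenericOrbit g (h ^ m * g) J (z i)).symm

end Covariance

section SecondMoment
variable {α : Type*} [Fintype α] [DecidableEq α]

/-- The words `h ^ i * g`. -/
def powWord (p : Bool → Perm α) (i : ℕ) : Perm α := p true ^ i * p false

lemma expect_powWord_shift (f : Perm α → Perm α → ℝ) (i m : ℕ) :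
    𝔼 p : Bool → Perm α, f (powWord p i) (powWord p (i + m)) =
      𝔼 p : Bool → Perm α, f (p false) (p true ^ m * p false) := by
  unfold powWord
  rw [expect_bool_fun (fun g h : Perm α => f (h ^ i * g) (h ^ (i + m) * g)),
    expect_bool_fun (fun g h : Perm α => f g (h ^ m * g))]
  refine Finset.expect_congr rfl fun h _ => ?_
  refine Fintype.expect_equiv (Equiv.mulLeft (h ^ i)) _ _ fun g => ?_
  rw [Equiv.coe_mulLeft, ← mul_assoc, ← pow_add, add_comm m i]

lemma pr_powWord (A : Perm α → Prop) (i : ℕ) :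
    pr (fun p : Bool → Perm α => A (powWord p i)) = pr A := by
  have h := expect_powWord_shift (fun u _ : Perm α => if A u then (1 : ℝ) else 0) i 0
  refine Eq.trans h ?_
  rw [expect_bool_fun (fun g _ : Perm α => if A g then (1 : ℝ) else 0),
    Finset.expect_const univ_nonempty]
  rfl

lemma expect_cyc_powWord (k i : ℕ) :
    𝔼 p : Bool → Perm α, cyc k (powWord p i) = 𝔼 u : Perm α, cyc k u := by
  have h := expect_powWord_shift (fun u _ : Perm α => cyc k u) i 0
  refine h.trans ?_
  rw [expect_bool_fun (fun g _ : Perm α => cyc k g), Finset.expect_const univ_nonempty]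

/-- The covariance error for words of length at most `M`. -/
noncomputable def covErr (k J M n : ℕ) : ℝ :=
  (k / J + (k : ℝ) ^ 2 * J ^ 2 / n) + k * (((M : ℝ) * J + 2) ^ 2 / ((n : ℝ) - (M * J + 2)))

lemma expect_cyc_powWord_mul_le {k : ℕ} (hk : 2 ≤ k) {J : ℕ} (hJ : 2 ≤ J) {M : ℕ}
    (hn : M * J + 2 < Fintype.card α) {i j : ℕ} (hij : i < j) (hj : j < M) :
    𝔼 p : Bool → Perm α, cyc k (powWord p i) * cyc k (powWord p j) ≤
      1 / k * (𝔼 u : Perm α, cyc k u) + covErr k J M (Fintype.card α) := by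
  obtain ⟨m, rfl⟩ := Nat.exists_eq_add_of_lt hij
  have hle : (m + 1 + 1) * J ≤ M * J := Nat.mul_le_mul_right _ (by omega)
  rw [add_assoc, expect_powWord_shift (fun u v : Perm α => cyc k u * cyc k v)]
  refine (expect_cyc_mul_cyc_pow_le hk hJ (Nat.le_add_left 1 m) (by omega)).trans ?_
  rw [covErr]
  refine le_trans ?_ (le_of_eq (add_assoc _ _ _))
  have h1 : (((m + 1 + 1) * J + 1 : ℕ) + 1 : ℝ) ≤ (M : ℝ) * J + 2 := by
    have : (m + 1 + 1) * J + 1 + 1 ≤ M * J + 2 := by omega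
    exact_mod_cast this
  have h2 : (0 : ℝ) < (Fintype.card α : ℝ) - (M * J + 2) := by
    rw [sub_pos]; exact_mod_cast hn
  gcongr

/-- With high probability one of the words `h ^ i * g` has a substantial cycle statistic. -/
lemma pr_forall_cyc_le {k : ℕ} (hk : 2 ≤ k) {J : ℕ} (hJ : 2 ≤ J) {M : ℕ} (hM : 1 ≤ M)
    (hn : M * J + 2 < Fintype.card α) :
    pr (fun p : Bool → Perm α => ∀ i < M, cyc k (powWord p i) ≤ 1 / (2 * k)) ≤
      4 * (k : ℝ) ^ 2 * (1 / M + (1 / Fintype.card α + covErr k J M (Fintype.card α))) := by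
  have hne : Nonempty α := Fintype.card_pos_iff.1 (by omega)
  set n : ℝ := (Fintype.card α : ℝ)
  set E := covErr k J M (Fintype.card α)
  set μ := 𝔼 u : Perm α, cyc k u
  have hk0 : (0 : ℝ) < k := by positivity
  have hM0 : (0 : ℝ) < M := by positivity
  have hn0 : 0 < n := by simp only [n]; positivity
  have hE0 : 0 ≤ E := by
    have h2 : (0 : ℝ) < (Fintype.card α : ℝ) - (M * J + 2) := by
      rw [sub_pos]; exact_mod_cast hn
    simp only [E, covErr]; positivity
  have hμ : 1 / (k : ℝ) - k / n ≤ μ := le_expect_cyc hk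
  have hk1 : 1 / (k : ℝ) ≤ 1 := by
    rw [div_le_one hk0]; exact_mod_cast (by omega : 1 ≤ k)
  set X : Fin M → (Bool → Perm α) → ℝ := fun i p => 1 / k - cyc k (powWord p i)
  have hpair : ∀ i j : Fin M, i < j → 𝔼 p, X i p * X j p ≤ 1 / n + E := by
    intro i j hij
    have h := expect_cyc_powWord_mul_le hk hJ hn (show (i : ℕ) < j from hij) j.2
    have e : ∀ p, X i p * X j p = (1 / (k : ℝ) ^ 2 - 1 / k * cyc k (powWord p i) -
        1 / k * cyc k (powWord p j)) + cyc k (powWord p i) * cyc k (powWord p j) := by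
      intro p; simp only [X]; field_simp; ring
    simp only [e]
    rw [Finset.expect_add_distrib, Finset.expect_sub_distrib, Finset.expect_sub_distrib,
      Finset.expect_const univ_nonempty, ← Finset.mul_expect, ← Finset.mul_expect,
      expect_cyc_powWord, expect_cyc_powWord]
    have h3 : 1 / (k : ℝ) ^ 2 - 1 / k * μ ≤ 1 / n := by
      have : 1 / (k : ℝ) * (1 / (k : ℝ) - k / n) ≤ 1 / k * μ := by gcongr
      have e2 : 1 / (k : ℝ) * (1 / (k : ℝ) - k / n) = 1 / (k : ℝ) ^ 2 - 1 / n := by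
        field_simp
      linarith
    linarith
  have hoff : ∀ i j : Fin M, i ≠ j → 𝔼 p, X i p * X j p ≤ 1 / n + E := by
    intro i j hij
    rcases lt_or_gt_of_ne hij with h | h
    · exact hpair i j h
    · simp only [mul_comm (X i _)]
      exact hpair j i h
  have hdiag : ∀ i : Fin M, 𝔼 p, X i p * X i p ≤ 1 := by
    intro i
    refine Finset.expect_le univ_nonempty fun p _ => ?_
    have h1 := cyc_nonneg k (powWord p i)
    have h2 := cyc_le_one k (powWord p i)
    have h3 : 0 ≤ 1 / (k : ℝ) := by positivity
    simp only [X]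
    nlinarith
  have hsq : 𝔼 p, (∑ i, X i p) ^ 2 ≤ M + M ^ 2 * (1 / n + E) := by
    simp only [pow_two (∑ i, X i _), Finset.sum_mul_sum]
    rw [Finset.expect_sum_comm]
    simp only [Finset.expect_sum_comm]
    have hb : ∀ i j : Fin M, 𝔼 p, X i p * X j p ≤ (if i = j then 1 else 0) + (1 / n + E) := by
      intro i j
      split_ifs with h
      · subst h
        have := hdiag i
        have : 0 ≤ 1 / n := by positivity
        linarith
      · rw [zero_add]; exact hoff i j h
    refine (Finset.sum_le_sum fun i _ => Finset.sum_le_sum fun j _ => hb i j).trans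
      (le_of_eq ?_)
    simp only [Finset.sum_add_distrib, Finset.sum_ite_eq, mem_univ, if_true, sum_const, card_univ,
      Fintype.card_fin, nsmul_eq_mul]
    ring
  have hmk := pr_markov (fun p => (∑ i, X i p) ^ 2) (fun p => sq_nonneg _)
    ((M : ℝ) ^ 2 / (4 * k ^ 2))
  have hmono : pr (fun p : Bool → Perm α => ∀ i < M, cyc k (powWord p i) ≤ 1 / (2 * k)) ≤
      pr (fun p => (M : ℝ) ^ 2 / (4 * k ^ 2) ≤ (∑ i, X i p) ^ 2) := by
    refine pr_mono fun p hp => ?_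
    have h1 : (M : ℝ) * (1 / (2 * k)) ≤ ∑ i, X i p := by
      have : ∑ _i : Fin M, 1 / (2 * (k : ℝ)) ≤ ∑ i, X i p := by
        refine Finset.sum_le_sum fun i _ => ?_
        have h := hp i i.2
        have e : 1 / (k : ℝ) = 1 / (2 * k) + 1 / (2 * k) := by field_simp; norm_num
        simp only [X]
        linarith
      rwa [sum_const, card_univ, Fintype.card_fin, nsmul_eq_mul] at this
    calc (M : ℝ) ^ 2 / (4 * k ^ 2) = ((M : ℝ) * (1 / (2 * k))) ^ 2 := by field_simp; norm_num
      _ ≤ _ := by gcongr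
  refine hmono.trans ?_
  have hc : 0 < (M : ℝ) ^ 2 / (4 * k ^ 2) := by positivity
  rw [← le_div_iff₀ hc] at hmk
  refine hmk.trans ?_
  rw [div_le_iff₀ hc]
  refine hsq.trans (le_of_eq ?_)
  field_simp

end SecondMoment

section LongCycle
variable {α : Type*} [Fintype α] [DecidableEq α]

lemma pr_forall_fin {P : α → Prop} (m : ℕ) :
    pr (fun f : Fin m → α => ∀ i, P (f i)) = pr P ^ m := by
  induction m with
  | zero => simp [pr]
  | succ m ih =>
    rw [← pr_equiv (Fin.consEquiv fun _ => α), pow_succ', ← ih, pr_mul_pr]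
    refine pr_congr fun q => ?_
    simp [Fin.forall_fin_succ, Fin.consEquiv]

lemma cyc_succ_le {u : Perm α} {θ : ℝ} (hθ : 0 ≤ θ) (m : ℕ)
    (h : ∀ x, pr (fun y => u.SameCycle x y) ≤ θ) : cyc (m + 1) u ≤ θ ^ m := by
  rw [cyc, ← pr_equiv (Fin.consEquiv fun _ => α)]
  refine pr_prod_le (by positivity) fun x => ?_
  calc _ ≤ pr (fun f : Fin m → α => ∀ i, u.SameCycle x (f i)) := by
        refine pr_mono fun f hf i => ?_
        have := hf 0 i.succ
        simpa [Fin.consEquiv] using this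
    _ = pr (fun y => u.SameCycle x y) ^ m := pr_forall_fin m
    _ ≤ θ ^ m := pow_le_pow_left₀ (pr_nonneg _) (h x) m

lemma exists_long_cycle {u : Perm α} (h : 1 / (2 * (200 : ℕ)) < cyc 200 u) :
    ∃ x, 23 / 24 < pr (fun y => u.SameCycle x y) := by
  by_contra hno
  push Not at hno
  have h1 := cyc_succ_le (by norm_num) 199 hno
  have h2 : ((23 : ℝ) / 24) ^ 199 ≤ 1 / (2 * (200 : ℕ)) := by norm_num
  norm_num at h h1 h2
  linarith

lemma le_pr_coord {k : ℕ} (i : Fin k) (P : α → Prop) [Nonempty α] :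
    pr P ≤ pr (fun z : Fin k → α => P (z i)) := by
  have h : pr (fun z : Fin k → α => ¬ P (z i)) ≤ pr (fun a => ¬ P a) := by
    refine pr_tuple_le i (pr_nonneg _) fun z => ?_
    simp only [Function.update_self, le_refl]
  rw [pr_compl, pr_compl] at h
  linarith

/-- The length of the cycle of `x`. -/
noncomputable def per (u : Perm α) (x : α) : ℕ := Function.minimalPeriod u x

lemma pow_per (u : Perm α) (x : α) : (u ^ per u x) x = x := by
  have := Function.isPeriodicPt_minimalPeriod u x
  rwa [Function.IsPeriodicPt, Function.IsFixedPt, Perm.iterate_eq_pow] at this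

lemma per_dvd {u : Perm α} {x : α} {s : ℕ} (h : (u ^ s) x = x) : per u x ∣ s := by
  refine Function.IsPeriodicPt.minimalPeriod_dvd ?_
  rwa [Function.IsPeriodicPt, Function.IsFixedPt, Perm.iterate_eq_pow]

lemma per_pos (u : Perm α) (x : α) : 0 < per u x := by
  have h : (u ^ orderOf u) x = x := by rw [pow_orderOf_eq_one, Perm.one_apply]
  exact Nat.pos_of_dvd_of_pos (per_dvd h) (orderOf_pos u)

lemma pow_per_of_sameCycle {u : Perm α} {x y : α} (h : u.SameCycle x y) :
    (u ^ per u x) y = y := by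
  obtain ⟨m, -, rfl⟩ := h.exists_pow_eq'
  rw [← Perm.mul_apply, ← pow_add, add_comm, pow_add, Perm.mul_apply, pow_per]

lemma per_eq_of_sameCycle {u : Perm α} {x y : α} (h : u.SameCycle x y) : per u y = per u x :=
  Nat.dvd_antisymm (per_dvd (pow_per_of_sameCycle h)) (per_dvd (pow_per_of_sameCycle h.symm))

lemma per_le_card (u : Perm α) (x : α) : per u x ≤ Fintype.card α := by
  rw [← Fintype.card_fin (per u x)]
  refine Fintype.card_le_of_injective (fun i : Fin (per u x) => (u ^ (i : ℕ)) x) ?_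
  have key : ∀ i j : Fin (per u x), (i : ℕ) ≤ j → (u ^ (i : ℕ)) x = (u ^ (j : ℕ)) x → i = j := by
    intro i j hle h
    have e : (u ^ ((j : ℕ) - i)) x = x := by
      apply (u ^ (i : ℕ)).injective
      rw [← Perm.mul_apply, ← pow_add, Nat.add_sub_cancel' hle, h]
    have h1 := Nat.eq_zero_of_dvd_of_lt (per_dvd e) (by omega)
    exact Fin.ext (by omega)
  intro i j h
  rcases le_total (i : ℕ) j with hle | hle
  · exact key i j hle h
  · exact (key j i hle h.symm).symm

lemma exists_dvd_of_mul_swap {u : Perm α} {a b : α} (hab : ¬ u.SameCycle a b)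
    (hd : per u b ∣ per u a) :
    ∃ t ∈ (per (u * swap a b) a).divisors, ((u * swap a b) ^ t) a = b := by
  set w := u * swap a b
  have wa : w a = u b := by simp [w]
  have wb : w b = u a := by simp [w]
  have wy : ∀ y, y ≠ a → y ≠ b → w y = u y := fun y h1 h2 => by
    simp [w, swap_apply_of_ne_of_ne h1 h2]
  have nb : ∀ s : ℕ, (u ^ s) b ≠ a := fun s h =>
    hab (h ▸ Perm.sameCycle_pow_left.2 (Perm.SameCycle.refl u b))
  have na : ∀ s : ℕ, (u ^ s) a ≠ b := fun s h =>
    hab (h ▸ Perm.sameCycle_pow_right.2 (Perm.SameCycle.refl u a))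
  have c1 : ∀ s, s + 1 ≤ per u b → (w ^ (s + 1)) a = (u ^ (s + 1)) b := by
    intro s
    induction s with
    | zero => intro _; simpa using wa
    | succ s ih =>
      intro hs
      rw [pow_succ', Perm.mul_apply, ih (by omega), wy _ (nb _), pow_succ' u (s + 1),
        Perm.mul_apply]
      intro h
      have := Nat.le_of_dvd (by omega) (per_dvd h)
      omega
  have c2 : ∀ s, s + 1 ≤ per u a → (w ^ (s + 1)) b = (u ^ (s + 1)) a := by
    intro s
    induction s with
    | zero => intro _; simpa using wb
    | succ s ih =>
      intro hs
      rw [pow_succ', Perm.mul_apply, ih (by omega), wy _ _ (na _), pow_succ' u (s + 1),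
        Perm.mul_apply]
      intro h
      have := Nat.le_of_dvd (by omega) (per_dvd h)
      omega
  have pb := per_pos u b
  have pa := per_pos u a
  have e1 : (w ^ per u b) a = b := by
    have := c1 (per u b - 1) (by omega)
    rwa [Nat.sub_add_cancel pb, pow_per] at this
  have e2 : (w ^ per u a) b = a := by
    have := c2 (per u a - 1) (by omega)
    rwa [Nat.sub_add_cancel pa, pow_per] at this
  have hL : per w a = per u a + per u b := by
    have hdvd : per w a ∣ per u a + per u b :=
      per_dvd (by rw [pow_add, Perm.mul_apply, e1, e2])
    refine le_antisymm (Nat.le_of_dvd (by omega) hdvd) ?_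
    by_contra hlt
    have pw := per_pos w a
    have hw := pow_per w a
    by_cases h1 : per w a ≤ per u b
    · have := c1 (per w a - 1) (by omega)
      rw [Nat.sub_add_cancel pw, hw] at this
      exact nb _ this.symm
    · have := c2 (per w a - per u b - 1) (by omega)
      rw [Nat.sub_add_cancel (by omega)] at this
      have e3 : (w ^ (per w a - per u b)) b = a := by
        have h5 : (w ^ (per w a - per u b)) ((w ^ per u b) a) = a := by
          rw [← Perm.mul_apply, ← pow_add, Nat.sub_add_cancel (by omega), hw]
        rwa [e1] at h5
      have h4 := Nat.le_of_dvd (by omega) (per_dvd (this.symm.trans e3))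
      omega
  refine ⟨per u b, Nat.mem_divisors.2 ⟨?_, (per_pos w a).ne'⟩, e1⟩
  rw [hL]
  exact dvd_add hd dvd_rfl

lemma card_divisors_le {n C L : ℕ} (hC : 0 < C) (hL : L ≤ n) :
    (L.divisors.card : ℝ) ≤ C + (n : ℝ) / C := by
  have hsub : L.divisors ⊆ (Finset.Icc 1 (L / C)) ∪ (Finset.range C).image (fun q => L / q) := by
    intro a ha
    obtain ⟨⟨q, rfl⟩, h0⟩ := Nat.mem_divisors.1 ha
    have ha0 : 0 < a := Nat.pos_of_ne_zero fun h => h0 (by simp [h])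
    have hq0 : 0 < q := Nat.pos_of_ne_zero fun h => h0 (by simp [h])
    rw [mem_union, mem_Icc, mem_image]
    by_cases h : q < C
    · exact Or.inr ⟨q, mem_range.2 h, Nat.mul_div_cancel _ hq0⟩
    · refine Or.inl ⟨ha0, (Nat.le_div_iff_mul_le hC).2 (Nat.mul_le_mul_left _ (by omega))⟩
  have h1 : L.divisors.card ≤ L / C + C := by
    refine (card_le_card hsub).trans ((card_union_le _ _).trans (add_le_add ?_ ?_))
    · rw [Nat.card_Icc, Nat.add_sub_cancel]
    · exact card_image_le.trans (by rw [card_range])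
  have h2 : ((L / C : ℕ) : ℝ) ≤ (n : ℝ) / C :=
    Nat.cast_div_le.trans (by gcongr)
  have h3 : (L.divisors.card : ℝ) ≤ ((L / C : ℕ) : ℝ) + C := by exact_mod_cast h1
  linarith

/-- A random point rarely has its cycle length dividing that of another cycle. -/
lemma expect_pr_dvd_le {k C : ℕ} (hC : 0 < C) {i j : Fin k} (hij : i ≠ j) [Nonempty α] :
    𝔼 u : Perm α, pr (fun z : Fin k → α => ¬ u.SameCycle (z i) (z j) ∧
      per u (z j) ∣ per u (z i)) ≤ (C + (Fintype.card α : ℝ) / C) / Fintype.card α := by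
  rw [expect_pr_comm]
  calc _ ≤ 𝔼 z : Fin k → α, pr (fun u : Perm α =>
        ∃ t ∈ (per u (z i)).divisors, (u ^ t) (z i) = z j) := by
        refine Finset.expect_le_expect fun z _ => ?_
        rw [← pr_equiv (Equiv.mulRight (swap (z i) (z j)))
          (fun u : Perm α => ∃ t ∈ (per u (z i)).divisors, (u ^ t) (z i) = z j)]
        exact pr_mono fun u hu => exists_dvd_of_mul_swap hu.1 hu.2
    _ = 𝔼 u : Perm α, pr (fun z : Fin k → α =>
        ∃ t ∈ (per u (z i)).divisors, (u ^ t) (z i) = z j) := expect_pr_comm _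
    _ ≤ _ := by
        refine Finset.expect_le univ_nonempty fun u _ => ?_
        refine pr_tuple_le j (by positivity) fun z => ?_
        simp only [Function.update_self, Function.update_of_ne hij]
        refine (pr_exists_mem_le _ _).trans ?_
        refine (Finset.sum_le_sum (g := fun _ => 1 / (Fintype.card α : ℝ)) fun t _ =>
          pr_eq_of_unique _ fun a ha => ha.symm).trans ?_
        rw [sum_const, nsmul_eq_mul, mul_one_div]
        gcongr
        exact card_divisors_le hC (per_le_card u _)

/-- The permutation `u` has a long cycle, whose length is a multiple of the order of `u`. -/
def Degenerate (u : Perm α) : Prop :=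
  ∃ x, 23 / 24 < pr (fun y => u.SameCycle x y) ∧ u ^ per u x = 1

lemma pr_degenerate_le {k C : ℕ} (hk : 2 ≤ k) (hC : 0 < C) [Nonempty α] :
    pr (fun u : Perm α => Degenerate u) ≤
      2 * (1 / k + (k : ℝ) ^ 2 / Fintype.card α +
        k * ((C + (Fintype.card α : ℝ) / C) / Fintype.card α)) := by
  set i₀ : Fin k := ⟨0, by omega⟩
  set D : Fin k → Perm α → ℝ := fun j u => if j = i₀ then 0 else
    pr (fun z : Fin k → α => ¬ u.SameCycle (z i₀) (z j) ∧ per u (z j) ∣ per u (z i₀))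
  have hD0 : ∀ j u, 0 ≤ D j u := by
    intro j u; simp only [D]; split_ifs
    · exact le_rfl
    · exact pr_nonneg _
  have hpt : ∀ u : Perm α, (if Degenerate u then (1 : ℝ) else 0) ≤
      2 * (cyc k u + ∑ j, D j u) := by
    intro u
    split_ifs with hu
    · obtain ⟨x, hx, hone⟩ := hu
      have h1 := le_pr_coord i₀ (fun y => u.SameCycle x y)
      have h2 : pr (fun z : Fin k → α => u.SameCycle x (z i₀)) ≤ cyc k u + ∑ j, D j u := by
        refine (pr_mono (B := fun z : Fin k → α => OneCycle u z ∨ ∃ j, j ≠ i₀ ∧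
          (¬ u.SameCycle (z i₀) (z j) ∧ per u (z j) ∣ per u (z i₀))) ?_).trans
          ((pr_or_le _ _).trans (add_le_add le_rfl ((pr_exists_le _).trans
            (Finset.sum_le_sum fun j _ => ?_))))
        · intro z hz
          by_cases h : ∀ j, u.SameCycle (z i₀) (z j)
          · exact Or.inl fun i j => (h i).symm.trans (h j)
          · push Not at h
            obtain ⟨j, hj⟩ := h
            refine Or.inr ⟨j, ?_, hj, ?_⟩
            · rintro rfl; exact hj (Perm.SameCycle.refl _ _)
            · rw [per_eq_of_sameCycle hz]
              exact per_dvd (by rw [hone, Perm.one_apply])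
        · simp only [D]
          split_ifs with hj
          · refine (pr_mono (B := fun _ => False) fun z h => h.1 hj).trans ?_
            simp [pr]
          · exact pr_mono fun z h => h.2
      linarith
    · have := cyc_nonneg k u
      have := Finset.sum_nonneg fun j (_ : j ∈ univ) => hD0 j u
      linarith
  calc pr (fun u : Perm α => Degenerate u) ≤ 𝔼 u : Perm α, 2 * (cyc k u + ∑ j, D j u) :=
        Finset.expect_le_expect fun u _ => hpt u
    _ = 2 * (𝔼 u : Perm α, cyc k u + ∑ j, 𝔼 u : Perm α, D j u) := by
        rw [← Finset.mul_expect, Finset.expect_add_distrib, Finset.expect_sum_comm]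
    _ ≤ _ := by
        gcongr
        · exact expect_cyc_le hk
        · refine (Finset.sum_le_sum (g := fun _ =>
            (C + (Fintype.card α : ℝ) / C) / Fintype.card α) fun j _ => ?_).trans
            (le_of_eq (by rw [sum_const, card_univ, Fintype.card_fin, nsmul_eq_mul]))
          by_cases hj : j = i₀
          · simp only [D, hj, if_true, Finset.expect_const_zero]
            positivity
          · simp only [D, hj, if_false]
            exact expect_pr_dvd_le hC (Ne.symm hj)

end LongCycle

section SmallSupport
variable {α : Type*} [Fintype α] [DecidableEq α]

lemma pr_mem_eq_ncard {Ω : Type*} [Fintype Ω] (G : Set Ω) :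
    pr (fun ω => ω ∈ G) = (G.ncard : ℝ) / Fintype.card Ω := by
  rw [pr_eq_card, ← Set.ncard_coe_finset]
  congr 3
  ext ω
  simp

lemma WL_powWord (p : Bool → Perm α) (i : ℕ) : WL p (i + 1) (powWord p i) :=
  (((WL.letter (p := p) true).pow i).mul (WL.letter false)).mono (by omega)

lemma small_support_pow_per {u : Perm α} {x : α} [Nonempty α]
    (hx : 23 / 24 < pr (fun y => u.SameCycle x y)) :
    24 * #(u ^ per u x).support ≤ Fintype.card α := by
  have h1 : pr (fun y => y ∈ (u ^ per u x).support) ≤ pr (fun y => ¬ u.SameCycle x y) :=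
    pr_mono fun y hy h => Perm.mem_support.1 hy (pow_per_of_sameCycle h)
  have h0 := pr_mem_eq_ncard (((u ^ per u x).support : Finset α) : Set α)
  simp only [mem_coe, Set.ncard_coe_finset] at h0
  rw [pr_compl, h0] at h1
  have hpos : (0 : ℝ) < Fintype.card α := by exact_mod_cast Fintype.card_pos
  have h2 : (#(u ^ per u x).support : ℝ) / Fintype.card α ≤ 1 / 24 := by linarith
  rw [div_le_iff₀ hpos] at h2
  have h3 : (24 : ℝ) * #(u ^ per u x).support ≤ Fintype.card α := by linarith
  exact_mod_cast h3

lemma exists_small_support_word {p : Bool → Perm α} {M i : ℕ} (hi : i < M)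
    (hc : 1 / (2 * (200 : ℕ)) < cyc 200 (powWord p i)) (hd : ¬ Degenerate (powWord p i)) :
    ∃ τ : Perm α, τ ≠ 1 ∧ WL p (M * Fintype.card α) τ ∧ 24 * #τ.support ≤ Fintype.card α := by
  obtain ⟨x, hx⟩ := exists_long_cycle hc
  have : Nonempty α := ⟨x⟩
  refine ⟨powWord p i ^ per (powWord p i) x, fun h => hd ⟨x, hx, h⟩,
    ((WL_powWord p i).pow _).mono (Nat.mul_le_mul hi (per_le_card _ _)),
    small_support_pow_per hx⟩

end SmallSupport

section Limits
open Filter Topology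

lemma tendsto_covErr (k J M : ℕ) :
    Tendsto (fun n : ℕ => covErr k J M n) atTop (𝓝 (k / J)) := by
  have h1 : Tendsto (fun n : ℕ => (k : ℝ) ^ 2 * J ^ 2 / n) atTop (𝓝 0) :=
    tendsto_const_div_atTop_nhds_zero_nat _
  have h2 : Tendsto (fun n : ℕ => ((M : ℝ) * J + 2) ^ 2 / ((n : ℝ) - (M * J + 2)))
      atTop (𝓝 0) :=
    (tendsto_atTop_add_const_right _ (-((M : ℝ) * J + 2))
      tendsto_natCast_atTop_atTop).const_div_atTop _
  simpa [covErr] using ((tendsto_const_nhds (x := (k : ℝ) / J)).add h1).add (h2.const_mul (k : ℝ))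

lemma exists_eventually_long_cycle (ε : ℝ) (hε : 0 < ε) :
    ∃ M : ℕ, 1 ≤ M ∧ ∀ᶠ n : ℕ in atTop,
      pr (fun p : Bool → Perm (Fin n) => ∀ i < M, cyc 200 (powWord p i) ≤ 1 / (2 * (200 : ℕ)))
        ≤ ε := by
  obtain ⟨M, hM⟩ := exists_nat_gt (640000 / ε)
  obtain ⟨J, hJ⟩ := exists_nat_gt (128000000 / ε)
  have hM1 : 1 ≤ M := by
    have : (0 : ℝ) < M := lt_trans (by positivity) hM
    exact_mod_cast this
  have hJ0 : (0 : ℝ) < J := lt_trans (by positivity) hJ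
  refine ⟨M, hM1, ?_⟩
  have hlim : Tendsto (fun n : ℕ => 4 * ((200 : ℕ) : ℝ) ^ 2 *
      (1 / M + (1 / (n : ℝ) + covErr 200 (J + 2) M n))) atTop
      (𝓝 (4 * ((200 : ℕ) : ℝ) ^ 2 * (1 / M + (0 + (200 : ℕ) / (J + 2 : ℕ))))) :=
    ((tendsto_const_nhds.add ((tendsto_const_div_atTop_nhds_zero_nat 1).add
      (tendsto_covErr 200 (J + 2) M))).const_mul _)
  have hlt : 4 * ((200 : ℕ) : ℝ) ^ 2 * (1 / M + (0 + (200 : ℕ) / (J + 2 : ℕ))) < ε := by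
    have hM0 : (0 : ℝ) < M := by exact_mod_cast hM1
    have a1 : 1 / (M : ℝ) < ε / 640000 := by
      rw [div_lt_iff₀ hε] at hM
      rw [div_lt_div_iff₀ hM0 (by norm_num)]
      linarith
    have a2 : (200 : ℝ) / (J + 2) < ε / 640000 := by
      rw [div_lt_iff₀ hε] at hJ
      rw [div_lt_div_iff₀ (by positivity) (by norm_num)]
      linarith
    push_cast
    linarith
  filter_upwards [hlim.eventually (gt_mem_nhds hlt), eventually_gt_atTop (M * (J + 2) + 2)]
    with n h1 h2
  have := pr_forall_cyc_le (α := Fin n) (k := 200) (by norm_num) (J := J + 2) (by omega) hM1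
    (by rwa [Fintype.card_fin])
  rw [Fintype.card_fin] at this
  exact this.trans h1.le

lemma eventually_pr_degenerate_le (ε : ℝ) (hε : 0 < ε) :
    ∀ᶠ n : ℕ in atTop, pr (fun u : Perm (Fin n) => Degenerate u) ≤ ε := by
  obtain ⟨k, hk⟩ := exists_nat_gt (8 / ε)
  obtain ⟨C, hC⟩ := exists_nat_gt (8 * ((k : ℝ) + 2) / ε)
  have hC0 : (0 : ℝ) < C := lt_trans (by positivity) hC
  have hlim : Tendsto (fun n : ℕ => 2 * (1 / ((k + 2 : ℕ) : ℝ) + ((k + 2 : ℕ) : ℝ) ^ 2 / n +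
      ((k + 2 : ℕ) : ℝ) * ((C : ℝ) / n + 1 / C))) atTop
      (𝓝 (2 * (1 / ((k + 2 : ℕ) : ℝ) + 0 + ((k + 2 : ℕ) : ℝ) * (0 + 1 / C)))) :=
    (((tendsto_const_nhds.add (tendsto_const_div_atTop_nhds_zero_nat _)).add
      (((tendsto_const_div_atTop_nhds_zero_nat _).add tendsto_const_nhds).const_mul _)).const_mul _)
  have hlt : 2 * (1 / ((k + 2 : ℕ) : ℝ) + 0 + ((k + 2 : ℕ) : ℝ) * (0 + 1 / C)) < ε := by
    have a1 : 1 / ((k : ℝ) + 2) < ε / 8 := by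
      rw [div_lt_iff₀ hε] at hk
      rw [div_lt_div_iff₀ (by positivity) (by norm_num)]
      linarith
    have a2 : ((k : ℝ) + 2) / C < ε / 8 := by
      rw [div_lt_iff₀ hε] at hC
      rw [div_lt_div_iff₀ hC0 (by norm_num)]
      linarith
    push_cast
    rw [zero_add, mul_one_div]
    linarith
  filter_upwards [hlim.eventually (gt_mem_nhds hlt), eventually_gt_atTop 0] with n h1 h2
  have : Nonempty (Fin n) := ⟨⟨0, h2⟩⟩
  refine (pr_degenerate_le (k := k + 2) (C := C) (by omega) (by exact_mod_cast hC0)).trans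
    (le_trans (le_of_eq ?_) h1.le)
  have hn : (n : ℝ) ≠ 0 := by exact_mod_cast h2.ne'
  rw [Fintype.card_fin]
  field_simp

lemma exists_eventually_small_support (ε : ℝ) (hε : 0 < ε) :
    ∃ M : ℕ, 1 ≤ M ∧ ∀ᶠ n : ℕ in atTop,
      pr (fun p : Bool → Perm (Fin n) => ¬ ∃ τ : Perm (Fin n), τ ≠ 1 ∧ WL p (M * n) τ ∧
        24 * #τ.support ≤ n) ≤ ε := by
  obtain ⟨M, hM, h⟩ := exists_eventually_long_cycle (ε / 2) (by positivity)
  have hM0 : (0 : ℝ) < M := by exact_mod_cast hM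
  refine ⟨M, hM, ?_⟩
  filter_upwards [h, eventually_pr_degenerate_le (ε / (2 * M)) (by positivity)] with n h1 h2
  calc _ ≤ pr (fun p : Bool → Perm (Fin n) =>
        (∀ i < M, cyc 200 (powWord p i) ≤ 1 / (2 * (200 : ℕ))) ∨
          ∃ i ∈ range M, Degenerate (powWord p i)) := by
        refine pr_mono fun p hp => ?_
        by_contra hno
        push Not at hno
        obtain ⟨⟨i, hi, hc⟩, hd⟩ := hno
        have := exists_small_support_word hi hc (hd i (mem_range.2 hi))
        rw [Fintype.card_fin] at this
        exact hp this
    _ ≤ ε / 2 + ∑ i ∈ range M, ε / (2 * M) := by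
        refine (pr_or_le _ _).trans (add_le_add h1 ((pr_exists_mem_le _ _).trans
          (Finset.sum_le_sum fun i _ => ?_)))
        rw [pr_powWord]
        exact h2
    _ = ε := by
        rw [sum_const, card_range, nsmul_eq_mul]
        field_simp
        ring

/-- Both ingredients together give short words for all 3-cycles. -/
lemma WL_threeCycle {n M : ℕ} {p : Bool → Perm (Fin n)} (hn : 3 ≤ n) (hM : M ≤ Nat.clog 2 n)
    (hL : mixLen n ≤ n) (hp : TwoMix p (mixLen n))
    (hs : ∃ τ : Perm (Fin n), τ ≠ 1 ∧ WL p (M * n) τ ∧ 24 * #τ.support ≤ n)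
    {σ : Perm (Fin n)} (hσ : σ.IsThreeCycle) : WL p (150 * (n * Nat.clog 2 n ^ 3)) σ := by
  obtain ⟨τ, hτ, hw, hsupp⟩ := hs
  set K := Nat.clog 2 n with hK
  have hK1 : 1 < K := by
    by_contra hlt
    have h2 : n ≤ 2 ^ K := Nat.le_pow_clog (by norm_num) n
    have := Nat.pow_le_pow_right (n := 2) (by norm_num) (show K ≤ 1 by omega)
    omega
  set d := Nat.clog 2 K with hd
  have hd1 : K ≤ 2 ^ d := Nat.le_pow_clog (by norm_num) K
  have hd2 : 2 ^ d ≤ 2 * K := by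
    have h := Nat.pow_pred_clog_lt_self (b := 2) (by norm_num) hK1
    have hpos : 0 < d := Nat.clog_pos (by norm_num) hK1
    rw [← hd] at h
    obtain ⟨e, he⟩ := Nat.exists_eq_add_of_lt hpos
    rw [he] at h ⊢
    simp only [zero_add, Nat.pred_eq_sub_one, Nat.add_sub_cancel] at h
    rw [zero_add, pow_succ]
    omega
  have hn0 : (0 : ℝ) < n := by exact_mod_cast (by omega : 0 < n)
  have hsmall : (12 * (#τ.support : ℝ) / Fintype.card (Fin n)) ^ 2 ^ d *
      Fintype.card (Fin n) ≤ 1 := by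
    rw [Fintype.card_fin]
    have hr : (24 : ℝ) * #τ.support ≤ n := by exact_mod_cast hsupp
    have hhalf : 12 * (#τ.support : ℝ) / n ≤ 1 / 2 := by
      rw [div_le_iff₀ hn0]; linarith
    have hpow : (n : ℝ) ≤ 2 ^ 2 ^ d := by
      have : n ≤ 2 ^ 2 ^ d := (Nat.le_pow_clog (by norm_num) n).trans
        (Nat.pow_le_pow_right (by norm_num) hd1)
      exact_mod_cast this
    calc _ ≤ (1 / 2 : ℝ) ^ 2 ^ d * 2 ^ 2 ^ d := by gcongr
      _ = 1 := by rw [← mul_pow]; norm_num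
  obtain ⟨ρ, hρ, hρw⟩ := exists_threeCycle_of_small_support hp d (M * n) τ hτ hw
    (by rwa [Fintype.card_fin]) hsmall
  refine (WL_threeCycle_of_exists hp hρ hρw hσ).mono ?_
  have h4 : 4 ^ (d + 1) ≤ 16 * K ^ 2 := by
    calc 4 ^ (d + 1) = 4 * (2 ^ d) ^ 2 := by rw [pow_succ, ← pow_mul, mul_comm d, pow_mul]; ring
      _ ≤ 4 * (2 * K) ^ 2 := by gcongr
      _ = 16 * K ^ 2 := by ring
  calc 3 * (4 ^ (d + 1) * (M * n + 2 * mixLen n) + 2 * mixLen n)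
      ≤ 3 * (16 * K ^ 2 * (K * n + 2 * (K * n)) + 2 * (K ^ 3 * n)) := by
        have a1 : mixLen n ≤ K * n := hL.trans (Nat.le_mul_of_pos_left n (by omega))
        have a2 : mixLen n ≤ K ^ 3 * n := hL.trans (Nat.le_mul_of_pos_left n (by positivity))
        gcongr
    _ = 150 * (n * K ^ 3) := by ring

lemma eventually_mixLen_le : ∀ᶠ n : ℕ in atTop, mixLen n ≤ n := by
  have h := (tendsto_clog_pow_div 2).eventually (gt_mem_nhds (show (0 : ℝ) < 1 / 9 by norm_num))
  filter_upwards [h, eventually_ge_atTop 2] with n h1 hn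
  have hn0 : (0 : ℝ) < n := by exact_mod_cast (by omega : 0 < n)
  rw [div_lt_iff₀ hn0] at h1
  have hK : 1 ≤ Nat.clog 2 n := Nat.clog_pos (by norm_num) (by omega)
  have h2 : 9 * Nat.clog 2 n ^ 2 ≤ n := by
    have : (9 : ℝ) * (Nat.clog 2 n : ℝ) ^ 2 ≤ n := by linarith
    exact_mod_cast this
  refine le_trans ?_ h2
  unfold mixLen
  nlinarith

lemma tendsto_clog_atTop : Tendsto (fun n : ℕ => Nat.clog 2 n) atTop atTop := by
  refine tendsto_atTop_mono (f := fun n : ℕ => Nat.log 2 n) (fun n => Nat.log_le_clog 2 n) ?_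
  refine tendsto_atTop.2 fun b => ?_
  filter_upwards [eventually_ge_atTop (2 ^ b)] with n hn
  exact Nat.le_log_of_pow_le (by norm_num) hn

lemma eventually_pr_not_short (ε : ℝ) (hε : 0 < ε) :
    ∀ᶠ n : ℕ in atTop, pr (fun p : Bool → Perm (Fin n) => ¬ ∀ σ : Perm (Fin n),
      σ.IsThreeCycle → WL p (150 * (n * Nat.clog 2 n ^ 3)) σ) ≤ ε := by
  obtain ⟨M, -, h⟩ := exists_eventually_small_support (ε / 2) (by positivity)
  filter_upwards [h, eventually_twoMix (ε / 2) (by positivity), eventually_mixLen_le,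
    tendsto_clog_atTop.eventually_ge_atTop M, eventually_ge_atTop 3] with n h1 h2 h3 h4 h5
  refine le_trans ((pr_mono fun p hp => ?_).trans
    ((pr_or_le _ _).trans (add_le_add h2 h1))) (by linarith)
  by_contra hno
  push Not at hno
  exact hp fun σ hσ => WL_threeCycle h5 h4 h3 hno.1 hno.2 hσ

end Limits

end RandGen

open RandGen

/-- **Random generators: short words for 3-cycles.**
There exist absolute constants `c, C > 0` such that, with probability `1 - o(1)` for a
random pair `(g, h) ∈ Sym(n) × Sym(n)`, every 3-cycle in `Sym(n)` is a product of at most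
`C·n·(log n)^c` elements of `S = {g, h, g⁻¹, h⁻¹}`. -/
theorem random_generators_three_cycles_short_words :
    ∃ c C : ℝ, 0 < c ∧ 0 < C ∧
      ∀ ε : ℝ, 0 < ε → ∃ N : ℕ, ∀ n : ℕ, N ≤ n →
        (1 - ε) * (Nat.factorial n : ℝ) ^ 2 ≤
          (Set.ncard {p : Perm (Fin n) × Perm (Fin n) |
              ∀ σ : Perm (Fin n), σ.IsThreeCycle →
                ∃ l : List (Perm (Fin n)),
                  (∀ s ∈ l, s = p.1 ∨ s = p.2 ∨ s = p.1⁻¹ ∨ s = p.2⁻¹) ∧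
                  l.prod = σ ∧
                  (l.length : ℝ) ≤ C * (n : ℝ) * Real.log n ^ c} : ℝ) := by
  refine ⟨3, 4050, by norm_num, by norm_num, fun ε hε => ?_⟩
  obtain ⟨N, hN⟩ := Filter.eventually_atTop.1 (eventually_pr_not_short ε hε)
  refine ⟨max N 3, fun n hn => ?_⟩
  have h := hN n ((le_max_left _ _).trans hn)
  have hn3 : 3 ≤ n := (le_max_right _ _).trans hn
  set G := {p : Perm (Fin n) × Perm (Fin n) | ∀ σ : Perm (Fin n), σ.IsThreeCycle →
    ∃ l : List (Perm (Fin n)), (∀ s ∈ l, s = p.1 ∨ s = p.2 ∨ s = p.1⁻¹ ∨ s = p.2⁻¹) ∧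
      l.prod = σ ∧ (l.length : ℝ) ≤ 4050 * (n : ℝ) * Real.log n ^ (3 : ℝ)} with hG
  have hlen : ((150 * (n * Nat.clog 2 n ^ 3) : ℕ) : ℝ) ≤
      4050 * (n : ℝ) * Real.log n ^ (3 : ℝ) := by
    have h3 := clog_le_log hn3
    have : (Nat.clog 2 n : ℝ) ^ 3 ≤ (3 * Real.log n) ^ 3 := by gcongr
    rw [show (3 : ℝ) = ((3 : ℕ) : ℝ) by norm_num, Real.rpow_natCast]
    push_cast
    calc (150 : ℝ) * (n * (Nat.clog 2 n : ℝ) ^ 3) ≤ 150 * (n * (3 * Real.log n) ^ 3) := by gcongr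
      _ = _ := by ring
  have h1 : pr (fun q : Perm (Fin n) × Perm (Fin n) => ¬ q ∈ G) ≤ ε := by
    rw [← pr_equiv (Equiv.boolArrowEquivProd (Perm (Fin n)))]
    refine (pr_mono fun p hp hgood => hp ?_).trans h
    intro σ hσ
    obtain ⟨l, hl, hprod, hlength⟩ := hgood σ hσ
    exact ⟨l, hl, hprod, le_trans (by exact_mod_cast hlength) hlen⟩
  rw [pr_compl, pr_mem_eq_ncard, Fintype.card_prod, Fintype.card_perm, Fintype.card_fin] at h1
  have hpos : (0 : ℝ) < (n.factorial * n.factorial : ℕ) := by positivity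
  rw [pow_two, ← Nat.cast_mul, ← le_div_iff₀ hpos]
  exact sub_le_comm.1 h1
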